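/- arXiv:2309.08509 — 2 statements merged into one kernel-verified Lean document; each statement's English description precedes it below -/
import Mathlib

section
/- Let Γ be a finite connected multigraph and let σ be a degree-d assignment for Γ that satisfies condition (1) (chip-adding) and such that |σ(G)| ≥ c(G) for every connected spanning subgraph G of Γ. Let m : Edges(Γ) → ℕ be the constant function 1, let Γ̃ := Γ̃_m be the subdivision of Γ in which each edge is subdivided once, and let σ̃ := σ̃_m be the lift of σ. If σ̃ is a minimal complete set of representatives for the action of the twister group tw(Γ̃) on S^d_{Γ̃}(Γ̃), then σ is a degree-d stability assignment for Γ. -/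
open Finset

variable {V E : Type} [Fintype V] [Fintype E] [DecidableEq V] [DecidableEq E]

/-- The unordered pair of endpoints of an edge. -/
def eSym (ends : E → V × V) (e : E) : Sym2 V := s((ends e).1, (ends e).2)

/-- Reachability in the spanning subgraph with edge set `A`. -/
def Linked (ends : E → V × V) (A : Finset E) : V → V → Prop :=
  Relation.ReflTransGen (fun v w => ∃ e ∈ A, eSym ends e = s(v, w))

/-- The spanning subgraph with edge set `A` is connected. -/
def Conn (ends : E → V × V) (A : Finset E) : Prop :=
  Nonempty V ∧ ∀ v w : V, Linked ends A v w

/-- The induced subgraph on the vertex set `W` is connected. -/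
def ConnOn (ends : E → V × V) (W : Finset V) : Prop :=
  W.Nonempty ∧ ∀ v ∈ W, ∀ w ∈ W,
    Relation.ReflTransGen (fun a b => a ∈ W ∧ b ∈ W ∧ ∃ e : E, eSym ends e = s(a, b)) v w

/-- A spanning tree: a connected spanning subgraph with `|V| - 1` edges. -/
def IsSpanningTree (ends : E → V × V) (A : Finset E) : Prop :=
  Conn ends A ∧ A.card + 1 = Fintype.card V

/-- The complexity of the spanning subgraph `A`: the number of its spanning trees. -/
noncomputable def complexity (ends : E → V × V) (A : Finset E) : ℕ :=
  Nat.card {T : Finset E // T ⊆ A ∧ IsSpanningTree ends T}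

/-- `n(G)`: the number of edges of `Γ` missing from the spanning subgraph `G`. -/
def nG (A : Finset E) : ℕ := (Finset.univ \ A).card

/-- The space of multidegrees of total degree `d` at `A`. -/
def Sdeg (d : ℤ) (A : Finset E) : Set (V → ℤ) :=
  {x | ∑ v, x v = d - (nG A : ℤ)}

/-- The twister at vertex `v` of the spanning subgraph with edge set `A`. -/
def twVec (ends : E → V × V) (A : Finset E) (v : V) : V → ℤ := fun w =>
  if w = v then
    -((A.filter (fun e => v ∈ eSym ends e ∧ ¬(eSym ends e).IsDiag)).card : ℤ)
  else ((A.filter (fun e => eSym ends e = s(v, w))).card : ℤ)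

/-- The twister (chip-firing) group of the spanning subgraph with edge set `A`. -/
def twGroup (ends : E → V × V) (A : Finset E) : AddSubgroup (V → ℤ) :=
  AddSubgroup.closure (Set.range (twVec ends A))

/-- The standard basis vector at `v`. -/
def stdVec (v : V) : V → ℤ := fun w => if w = v then 1 else 0

/-- A degree-`d` assignment: supported on connected spanning subgraphs, with the
prescribed total degree. -/
def IsAssignment (ends : E → V × V) (d : ℤ) (σ : Finset E → Set (V → ℤ)) : Prop :=
  ∀ A : Finset E, ∀ x ∈ σ A, Conn ends A ∧ x ∈ Sdeg d A

/-- Condition (1), chip-adding. -/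
def ChipAdding (ends : E → V × V) (σ : Finset E → Set (V → ℤ)) : Prop :=
  ∀ A : Finset E, ∀ x ∈ σ A, ∀ e ∉ A, ∀ v ∈ eSym ends e, x + stdVec v ∈ σ (insert e A)

/-- `S` is a minimal complete set of representatives for the action of the twister group
of `A` on the multidegree space `S^d(A)`. -/
def IsRepSet (ends : E → V × V) (d : ℤ) (A : Finset E) (S : Set (V → ℤ)) : Prop :=
  S ⊆ Sdeg d A ∧ ∀ x ∈ Sdeg (E := E) d A, ∃! y, y ∈ S ∧ x - y ∈ twGroup ends A

/-- A degree-`d` stability assignment. -/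
def IsStabilityAssignment (ends : E → V × V) (d : ℤ) (σ : Finset E → Set (V → ℤ)) : Prop :=
  IsAssignment ends d σ ∧ ChipAdding ends σ ∧
    ∀ A : Finset E, Conn ends A → IsRepSet ends d A (σ A)

/-- Vertices of the subdivision `Γ̃_m`: original vertices plus, for each edge `e`,
`m e` exceptional vertices. -/
abbrev SubV (V E : Type) (m : E → ℕ) : Type := V ⊕ (Σ e : E, Fin (m e))

/-- Edges of the subdivision `Γ̃_m`: each edge `e` is replaced by a chain of `m e + 1` edges. -/
abbrev SubE (E : Type) (m : E → ℕ) : Type := Σ e : E, Fin (m e + 1)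

/-- The `i`-th vertex along the chain replacing the edge `e` in the subdivision. -/
def subNode (ends : E → V × V) (m : E → ℕ) (e : E) (i : ℕ) : SubV V E m :=
  if h0 : i = 0 then Sum.inl (ends e).1
  else if h : i ≤ m e then Sum.inr ⟨e, ⟨i - 1, by omega⟩⟩
  else Sum.inl (ends e).2

/-- The endpoints of the edges of the subdivision `Γ̃_m`. -/
def subEnds (ends : E → V × V) (m : E → ℕ) : SubE E m → SubV V E m × SubV V E m :=
  fun p => (subNode ends m p.1 p.2.val, subNode ends m p.1 (p.2.val + 1))

/-- The lift of the multidegree `x` on `(A, Γ)`: extend by zero and add one chip on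
the exceptional vertex `t e` of every removed edge `e ∉ A`. -/
def liftOf (m : E → ℕ) (A : Finset E) (x : V → ℤ) (t : E → ℕ) : SubV V E m → ℤ :=
  Sum.elim x fun p => if p.1 ∉ A ∧ (p.2 : ℕ) = t p.1 then 1 else 0

/-- The lift `σ̃_m` of an assignment `σ`: all lifts of all elements of `σ`. -/
def liftSet (m : E → ℕ) (σ : Finset E → Set (V → ℤ)) : Set (SubV V E m → ℤ) :=
  {y | ∃ (A : Finset E) (x : V → ℤ) (t : E → ℕ),
    x ∈ σ A ∧ (∀ e ∉ A, t e < m e) ∧ y = liftOf m A x t}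

/-- Edges with both endpoints in `W` (the edges of the induced subgraph `Γ(W)`). -/
def inE (ends : E → V × V) (W : Finset V) : Finset E :=
  Finset.univ.filter fun e => (ends e).1 ∈ W ∧ (ends e).2 ∈ W

/-- Edges with one endpoint in `W` and the other in `Wᶜ`. -/
def cutE (ends : E → V × V) (W : Finset V) : Finset E :=
  Finset.univ.filter fun e =>
    ((ends e).1 ∈ W ∧ (ends e).2 ∉ W) ∨ ((ends e).1 ∉ W ∧ (ends e).2 ∈ W)

/-- `φ`-semistability of the multidegree `x` on the spanning subgraph `A`. -/
def PhiSemistable (ends : E → V × V) (φ : V → ℝ) (A : Finset E) (x : V → ℤ) : Prop :=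
  ∀ W : Finset V, W.Nonempty → W ≠ Finset.univ →
    |(∑ v ∈ W, ((x v : ℝ) - φ v)) + (((Finset.univ \ A) ∩ inE ends W).card : ℝ) +
        (((Finset.univ \ A) ∩ cutE ends W).card : ℝ) / 2| ≤
      ((A ∩ cutE ends W).card : ℝ) / 2

/-- `φ`-stability of the multidegree `x` on the spanning subgraph `A`. -/
def PhiStable (ends : E → V × V) (φ : V → ℝ) (A : Finset E) (x : V → ℤ) : Prop :=
  ∀ W : Finset V, W.Nonempty → W ≠ Finset.univ →
    |(∑ v ∈ W, ((x v : ℝ) - φ v)) + (((Finset.univ \ A) ∩ inE ends W).card : ℝ) +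
        (((Finset.univ \ A) ∩ cutE ends W).card : ℝ) / 2| <
      ((A ∩ cutE ends W).card : ℝ) / 2

/-- Nondegeneracy of a numerical polarization `φ`. -/
def Nondegenerate (ends : E → V × V) (d : ℤ) (φ : V → ℝ) : Prop :=
  ∀ A : Finset E, ∀ x ∈ Sdeg d A, PhiSemistable ends φ A x → PhiStable ends φ A x

/-- The assignment `stab_{Γ,φ}` associated with a numerical polarization `φ`. -/
def stabAssign (ends : E → V × V) (d : ℤ) (φ : V → ℝ) : Finset E → Set (V → ℤ) :=
  fun A => {x | Conn ends A ∧ x ∈ Sdeg d A ∧ PhiSemistable ends φ A x}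

/-- The valence of the vertex `v` (loops counted twice). -/
def valence (ends : E → V × V) (v : V) : ℕ :=
  ∑ e : E, ((if (ends e).1 = v then 1 else 0) + (if (ends e).2 = v then 1 else 0))

/-- `x` is an integral break divisor for the connected spanning subgraph `A`. -/
def isIBD (ends : E → V × V) (gen : V → ℕ) (A : Finset E) (x : V → ℤ) : Prop :=
  ∃ T : Finset E, T ⊆ A ∧ IsSpanningTree ends T ∧
    ∃ t : E → V, (∀ e ∈ A \ T, t e ∈ eSym ends e) ∧
      x = fun v => (gen v : ℤ) + (((A \ T).filter fun e => t e = v).card : ℤ)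

/-- The multidegree `(a, b)` on a two-vertex graph with first vertex `v₁`. -/
def pairFn (v₁ : V) (a b : ℤ) : V → ℤ := fun w => if w = v₁ then a else b

set_option linter.unusedSectionVars false

section Graph

variable (ends : E → V × V)

/-- The boundary of an edge: its head minus its tail. -/
def edgeVec (e : E) : V → ℤ := stdVec (ends e).2 - stdVec (ends e).1

lemma sum_mul_stdVec (f : V → ℤ) (v : V) : ∑ w, f w * stdVec v w = f v := by
  simp [stdVec]

lemma sum_stdVec (v : V) : ∑ w, stdVec v w = 1 := by
  simp [stdVec]

lemma sum_mul_edgeVec (f : V → ℤ) (e : E) :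
    ∑ w, f w * edgeVec ends e w = f (ends e).2 - f (ends e).1 := by
  simp only [edgeVec, Pi.sub_apply, mul_sub, Finset.sum_sub_distrib, sum_mul_stdVec]

lemma sum_edgeVec (e : E) : ∑ w, edgeVec ends e w = 0 := by
  simpa using sum_mul_edgeVec ends (fun _ => 1) e

lemma sum_mul_sum_edgeVec (f : V → ℤ) (A : Finset E) (a : E → ℤ) :
    ∑ w, f w * (∑ e ∈ A, a e • edgeVec ends e) w =
      ∑ e ∈ A, a e * (f (ends e).2 - f (ends e).1) := by
  simp only [Finset.sum_apply, Pi.smul_apply, smul_eq_mul, Finset.mul_sum]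
  rw [Finset.sum_comm]
  refine Finset.sum_congr rfl fun e _ => ?_
  rw [← sum_mul_edgeVec, Finset.mul_sum]
  exact Finset.sum_congr rfl fun w _ => by ring

variable {ends}

lemma Linked.trans {A : Finset E} {u v w : V} (h : Linked ends A u v) (h' : Linked ends A v w) :
    Linked ends A u w := Relation.ReflTransGen.trans h h'

lemma linked_edge {A : Finset E} {e : E} (he : e ∈ A) :
    Linked ends A (ends e).1 (ends e).2 :=
  Relation.ReflTransGen.single ⟨e, he, rfl⟩

lemma linked_edge_symm {A : Finset E} {e : E} (he : e ∈ A) :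
    Linked ends A (ends e).2 (ends e).1 :=
  Relation.ReflTransGen.single ⟨e, he, Sym2.eq_swap⟩

/-- A predicate on vertices that is preserved by the edges of `A` in both directions is constant
along walks. -/
lemma Linked.induct {A : Finset E} {u v : V} (h : Linked ends A u v) {P : V → Prop}
    (hP : ∀ e ∈ A, P (ends e).1 ↔ P (ends e).2) (hu : P u) : P v := by
  induction h with
  | refl => exact hu
  | tail _ hstep ih =>
    obtain ⟨e, he, heq⟩ := hstep
    rcases Sym2.eq_iff.1 heq with ⟨h1, h2⟩ | ⟨h1, h2⟩
    · rw [← h2, ← hP e he, h1]; exact ih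
    · rw [← h1, hP e he, h2]; exact ih

lemma Linked.symm {A : Finset E} {u v : V} (h : Linked ends A u v) : Linked ends A v u :=
  h.induct (P := fun w => Linked ends A w u)
    (fun _ he => ⟨(linked_edge_symm he).trans, (linked_edge he).trans⟩) .refl

lemma linked_iff_of_mem {A : Finset E} (u : V) {e : E} (he : e ∈ A) :
    Linked ends A u (ends e).1 ↔ Linked ends A u (ends e).2 :=
  ⟨fun h => h.trans (linked_edge he), fun h => h.trans (linked_edge_symm he)⟩

lemma conn_of_linked {A : Finset E} (q : V) (h : ∀ v, Linked ends A q v) : Conn ends A :=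
  ⟨⟨q⟩, fun v w => (h v).symm.trans (h w)⟩

lemma Linked.mono {A B : Finset E} (hAB : A ⊆ B) {u v : V} (h : Linked ends A u v) :
    Linked ends B u v :=
  h.induct (fun _ he => linked_iff_of_mem u (hAB he)) .refl

lemma Conn.mono {A B : Finset E} (hAB : A ⊆ B) (h : Conn ends A) : Conn ends B :=
  ⟨h.1, fun v w => (h.2 v w).mono hAB⟩

lemma Conn.erase {A : Finset E} (h : Conn ends A) {e : E}
    (he : Linked ends (A.erase e) (ends e).2 (ends e).1) : Conn ends (A.erase e) := by
  refine conn_of_linked (ends e).1 fun v => (h.2 _ v).induct (fun f hf => ?_) .refl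
  by_cases hfe : f = e
  · subst hfe
    exact iff_of_true .refl he.symm
  · exact linked_iff_of_mem _ (Finset.mem_erase.2 ⟨hfe, hf⟩)

variable (ends) in
lemma exists_edgeVec_sum_of_linked {A : Finset E} {u v : V} (h : Linked ends A u v) :
    ∃ a : E → ℤ, stdVec v - stdVec u = ∑ e ∈ A, a e • edgeVec ends e := by
  refine h.induct (P := fun w => ∃ a : E → ℤ,
    stdVec w - stdVec u = ∑ e ∈ A, a e • edgeVec ends e) (fun e he => ?_) ⟨0, by simp⟩
  have key : ∀ k : ℤ, ∑ f ∈ A, (if f = e then k else 0) • edgeVec ends f = k • edgeVec ends e := by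
    intro k
    simp [ite_smul, he]
  constructor
  · rintro ⟨a, ha⟩
    refine ⟨fun f => a f + if f = e then 1 else 0, ?_⟩
    simp only [add_smul, Finset.sum_add_distrib, key, ← ha]
    simp [edgeVec]
  · rintro ⟨a, ha⟩
    refine ⟨fun f => a f + if f = e then -1 else 0, ?_⟩
    simp only [add_smul, Finset.sum_add_distrib, key, ← ha]
    simp [edgeVec]

/-- The edge vectors of a connected graph generate the lattice of vectors of degree zero. -/
lemma Conn.exists_edgeVec_sum {A : Finset E} (h : Conn ends A) {x : V → ℤ}
    (hx : ∑ v, x v = 0) : ∃ a : E → ℤ, x = ∑ e ∈ A, a e • edgeVec ends e := by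
  obtain ⟨q⟩ := h.1
  choose a ha using fun v => exists_edgeVec_sum_of_linked ends (h.2 q v)
  refine ⟨fun e => ∑ v, x v * a v e, ?_⟩
  have h1 : x = ∑ v, x v • (stdVec v - stdVec q) := by
    simp only [smul_sub, Finset.sum_sub_distrib, ← Finset.sum_smul, hx, zero_smul, sub_zero]
    ext w
    simp [stdVec]
  conv_lhs => rw [h1]
  simp only [ha, Finset.smul_sum, Finset.sum_smul, mul_smul]
  exact Finset.sum_comm

lemma Conn.card_le {A : Finset E} (h : Conn ends A) : Fintype.card V ≤ A.card + 1 := by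
  obtain ⟨q⟩ := id h.1
  set S : Finset (V → ℤ) := insert (stdVec q) (A.image (edgeVec ends)) with hS
  have hspan : Submodule.span ℤ (S : Set (V → ℤ)) = ⊤ := by
    rw [eq_top_iff]
    intro x _
    obtain ⟨a, ha⟩ := h.exists_edgeVec_sum (x := x - (∑ v, x v) • stdVec q)
      (by simp [← Finset.mul_sum, sum_stdVec])
    have : x = (∑ v, x v) • stdVec q + ∑ e ∈ A, a e • edgeVec ends e := by
      rw [← ha]; abel
    rw [this]
    refine Submodule.add_mem _ (Submodule.smul_mem _ _ (Submodule.subset_span ?_))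
      (Submodule.sum_mem _ fun e he => Submodule.smul_mem _ _ (Submodule.subset_span ?_))
    · simp [hS]
    · exact Finset.mem_coe.2 (Finset.mem_insert_of_mem (Finset.mem_image_of_mem _ he))
  have h1 := finrank_span_finset_le_card (R := ℤ) S
  rw [Set.finrank, hspan, finrank_top, Module.finrank_fintype_fun_eq_card] at h1
  calc _ ≤ S.card := h1
    _ ≤ (A.image (edgeVec ends)).card + 1 := Finset.card_insert_le _ _
    _ ≤ _ := by gcongr; exact Finset.card_image_le

lemma Conn.exists_edge {A : Finset E} (h : Conn ends A) (f : V → ℤ) {q : V} (hq : f q = 0)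
    (hf : ∀ e ∈ A, f (ends e).1 = f (ends e).2) : f = 0 := by
  ext v
  exact (h.2 q v).induct (P := fun w => f w = 0) (fun e he => by rw [hf e he]) hq

end Graph

section MatrixTree

/-- A form of the Cauchy–Binet formula: if the squares of the maximal minors of `M` are the
indicator of a family of column sets, then `det (M * Mᵀ)` counts the family. -/
lemma det_mul_transpose_eq_card {n m : Type*} [Fintype n] [DecidableEq n] [Fintype m]
    [DecidableEq m] (M : Matrix n m ℤ) (P : Finset m → Prop) [DecidablePred P]
    (hM : ∀ p : n → m, Function.Injective p →
      (M.submatrix id p).det ^ 2 = if P (Finset.univ.image p) then 1 else 0) :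
    (M * M.transpose).det =
      ((Finset.univ.powersetCard (Fintype.card n)).filter P).card := by
  have h1 : (M * M.transpose).det =
      ∑ p : n → m, (∏ i, M i (p i)) * (M.submatrix id p).det := by
    simp only [Matrix.det_apply', Matrix.mul_apply, Matrix.transpose_apply,
      Finset.prod_univ_sum, Fintype.piFinset_univ, Finset.mul_sum, Matrix.submatrix_apply, id]
    rw [Finset.sum_comm]
    refine Finset.sum_congr rfl fun p _ => Finset.sum_congr rfl fun s _ => ?_
    rw [Finset.prod_mul_distrib]
    ring
  have h2 : (M * M.transpose).det = ∑ p : n → m with Function.Injective p,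
      (∏ i, M i (p i)) * (M.submatrix id p).det := by
    rw [h1, Finset.sum_filter]
    refine Finset.sum_congr rfl fun p _ => ?_
    split_ifs with hp
    · rfl
    · rw [Function.not_injective_iff] at hp
      obtain ⟨i, j, hij, hne⟩ := hp
      rw [Matrix.det_zero_of_column_eq hne (fun k => by simp [hij]), mul_zero]
  have hmaps : ∀ p ∈ (Finset.univ.filter Function.Injective : Finset (n → m)),
      Finset.univ.image p ∈ (Finset.univ : Finset m).powersetCard (Fintype.card n) := by
    intro p hp
    rw [Finset.mem_powersetCard]
    exact ⟨Finset.subset_univ _,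
      Finset.card_image_of_injective _ (Finset.mem_filter.1 hp).2⟩
  rw [h2, ← Finset.sum_fiberwise_of_maps_to hmaps, Finset.card_filter, Nat.cast_sum]
  refine Finset.sum_congr rfl fun S hS => ?_
  rw [Finset.mem_powersetCard] at hS
  obtain ⟨e⟩ : Nonempty (n ≃ S) := Fintype.card_eq.1 (by simp [hS.2])
  set p₀ : n → m := fun i => e i with hp₀
  have hinj : Function.Injective p₀ := Subtype.val_injective.comp e.injective
  have him : Finset.univ.image p₀ = S := by
    ext x
    simp only [Finset.mem_image, Finset.mem_univ, true_and]
    exact ⟨fun ⟨i, hi⟩ => hi ▸ (e i).2, fun hx => ⟨e.symm ⟨x, hx⟩, by simp [hp₀]⟩⟩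
  have h3 : ∑ p ∈ (Finset.univ.filter Function.Injective : Finset (n → m)) with
        Finset.univ.image p = S, (∏ i, M i (p i)) * (M.submatrix id p).det =
      ∑ s : Equiv.Perm n, (∏ i, M i (p₀ (s i))) * (M.submatrix id (p₀ ∘ s)).det := by
    symm
    refine Finset.sum_bij (fun s _ => p₀ ∘ s) ?_ ?_ ?_ ?_
    · intro s _
      simp only [Finset.mem_filter, Finset.mem_univ, true_and]
      refine ⟨hinj.comp s.injective, ?_⟩
      rw [← him, ← Finset.image_image, Finset.image_univ_of_surjective s.surjective]
    · intro s _ t _ hst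
      ext i
      exact hinj (congrFun hst i)
    · intro p hp
      simp only [Finset.mem_filter, Finset.mem_univ, true_and] at hp
      have hmem : ∀ i, p i ∈ S := fun i => hp.2 ▸ Finset.mem_image_of_mem p (Finset.mem_univ i)
      have hbij : Function.Injective fun i => e.symm ⟨p i, hmem i⟩ := by
        intro i j hij
        have := e.symm.injective hij
        exact hp.1 (congrArg Subtype.val this)
      refine ⟨Equiv.ofBijective _ (Finite.injective_iff_bijective.1 hbij), Finset.mem_univ _, ?_⟩
      ext i
      simp [hp₀]
    · intro s _
      rfl
  have h4 : (M.submatrix id p₀).det =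
      ∑ s : Equiv.Perm n, (Equiv.Perm.sign s : ℤ) * ∏ i, M i (p₀ (s i)) := by
    rw [← Matrix.det_transpose, Matrix.det_apply']
    rfl
  have h5 : ∀ s : Equiv.Perm n, (M.submatrix id (p₀ ∘ s)).det =
      (Equiv.Perm.sign s : ℤ) * (M.submatrix id p₀).det := fun s => by
    exact Matrix.det_permute' s (M.submatrix id p₀)
  have h6 := hM p₀ hinj
  rw [him] at h6
  push_cast
  rw [h3, ← h6, sq]
  conv_rhs => rw [h4, Finset.sum_mul]
  refine Finset.sum_congr rfl fun s _ => ?_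
  rw [h5, h4]
  ring

variable (ends : E → V × V)

lemma twVec_eq (A : Finset E) (v : V) :
    twVec ends A v = -∑ e ∈ A, edgeVec ends e v • edgeVec ends e := by
  ext w
  simp only [twVec, Pi.neg_apply, Finset.sum_apply, Pi.smul_apply, smul_eq_mul,
    Finset.card_filter, Nat.cast_sum]
  split_ifs with h
  · subst h
    congr 1
    refine Finset.sum_congr rfl fun e _ => ?_
    simp only [eSym, edgeVec, stdVec, Pi.sub_apply, Sym2.mem_iff, Sym2.mk_isDiag_iff]
    grind
  · rw [← Finset.sum_neg_distrib]
    refine Finset.sum_congr rfl fun e _ => ?_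
    simp only [eSym, edgeVec, stdVec, Pi.sub_apply, Sym2.eq_iff]
    grind

/-- The Laplacian of any integral function on the vertices lies in the twister group. -/
lemma laplacian_mem_twGroup (A : Finset E) (f : V → ℤ) :
    ∑ e ∈ A, (f (ends e).2 - f (ends e).1) • edgeVec ends e ∈ twGroup ends A := by
  have h : ∑ e ∈ A, (f (ends e).2 - f (ends e).1) • edgeVec ends e =
      ∑ v, -f v • twVec ends A v := by
    simp only [twVec_eq, neg_smul_neg, ← sum_mul_edgeVec, Finset.sum_smul, Finset.smul_sum,
      mul_smul]
    rw [Finset.sum_comm]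
  rw [h]
  exact AddSubgroup.sum_mem _ fun v _ =>
    AddSubgroup.zsmul_mem _ (AddSubgroup.subset_closure (Set.mem_range_self v)) _

lemma exists_laplacian_of_mem_twGroup {A : Finset E} {x : V → ℤ} (hx : x ∈ twGroup ends A) :
    ∃ f : V → ℤ, x = ∑ e ∈ A, (f (ends e).2 - f (ends e).1) • edgeVec ends e := by
  refine AddSubgroup.closure_induction (p := fun x _ => ∃ f : V → ℤ,
    x = ∑ e ∈ A, (f (ends e).2 - f (ends e).1) • edgeVec ends e) ?_ ⟨0, by simp⟩ ?_ ?_ hx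
  · rintro _ ⟨v, rfl⟩
    refine ⟨-stdVec v, ?_⟩
    rw [twVec_eq, ← Finset.sum_neg_distrib]
    refine Finset.sum_congr rfl fun e _ => ?_
    rw [← neg_smul]
    congr 1
    simp only [edgeVec, stdVec, Pi.sub_apply, Pi.neg_apply, eq_comm (a := v)]
    ring
  · rintro _ _ _ _ ⟨f, rfl⟩ ⟨g, rfl⟩
    refine ⟨f + g, ?_⟩
    rw [← Finset.sum_add_distrib]
    refine Finset.sum_congr rfl fun e _ => ?_
    rw [← add_smul]
    congr 1
    simp only [Pi.add_apply]
    ring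
  · rintro _ _ ⟨f, rfl⟩
    refine ⟨-f, ?_⟩
    rw [← Finset.sum_neg_distrib]
    refine Finset.sum_congr rfl fun e _ => ?_
    rw [← neg_smul]
    congr 1
    simp only [Pi.neg_apply]
    ring

lemma sum_eq_zero_of_mem_twGroup {A : Finset E} {x : V → ℤ} (hx : x ∈ twGroup ends A) :
    ∑ v, x v = 0 := by
  obtain ⟨f, rfl⟩ := exists_laplacian_of_mem_twGroup ends hx
  simpa using sum_mul_sum_edgeVec ends (fun _ => 1) A _

/-- The incidence matrix of `A`, augmented by one column marking the root `q`. -/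
def rootedIncidence (A : Finset E) (q : V) : Matrix V (Option E) ℤ := fun v o =>
  o.elim (stdVec q v) fun e => if e ∈ A then edgeVec ends e v else 0

variable {ends}

lemma rootedIncidence_mulVec (A : Finset E) (q : V) (z : Option E → ℤ) :
    (rootedIncidence ends A q).mulVec z =
      z none • stdVec q + ∑ e ∈ A, z (some e) • edgeVec ends e := by
  ext v
  simp [Matrix.mulVec, dotProduct, Fintype.sum_option, rootedIncidence, mul_comm]

lemma vecMul_rootedIncidence_none (A : Finset E) (q : V) (f : V → ℤ) :
    ∑ v, f v * rootedIncidence ends A q v none = f q := by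
  simp [rootedIncidence, sum_mul_stdVec]

lemma vecMul_rootedIncidence_some {A : Finset E} (q : V) (f : V → ℤ) {e : E} (he : e ∈ A) :
    ∑ v, f v * rootedIncidence ends A q v (some e) = f (ends e).2 - f (ends e).1 := by
  simp [rootedIncidence, he, sum_mul_edgeVec]

/-- The square of a maximal minor of the rooted incidence matrix is one or zero, according to
whether the chosen columns form a rooted connected graph. -/
lemma det_rootedIncidence_sq (A : Finset E) (q : V) (p : V → Option E)
    (hp : Function.Injective p)
    [Decidable (none ∈ Finset.univ.image p ∧ (Finset.univ.image p).eraseNone ⊆ A ∧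
      Conn ends (Finset.univ.image p).eraseNone)] :
    ((rootedIncidence ends A q).submatrix id p).det ^ 2 =
      if none ∈ Finset.univ.image p ∧ (Finset.univ.image p).eraseNone ⊆ A ∧
        Conn ends (Finset.univ.image p).eraseNone then 1 else 0 := by
  classical
  set T := (Finset.univ.image p).eraseNone with hT
  have hmem : ∀ e, e ∈ T ↔ ∃ v, p v = some e := fun e => by
    simp [hT, Finset.mem_eraseNone]
  have hzero : ∀ f : V → ℤ, f ≠ 0 →
      (∀ v, ∑ w, f w * rootedIncidence ends A q w (p v) = 0) →
      ((rootedIncidence ends A q).submatrix id p).det = 0 := fun f hf h =>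
    Matrix.exists_vecMul_eq_zero_iff.1 ⟨f, hf, funext h⟩
  split_ifs with h
  · obtain ⟨hnone, hTA, hconn⟩ := h
    have hsurj : Function.Surjective ((rootedIncidence ends A q).submatrix id p).mulVec := by
      intro y
      obtain ⟨a, ha⟩ := hconn.exists_edgeVec_sum (x := y - (∑ v, y v) • stdVec q)
        (by simp [← Finset.mul_sum, sum_stdVec])
      set z : Option E → ℤ := fun o => o.elim (∑ v, y v) fun e => if e ∈ T then a e else 0
        with hz
      refine ⟨z ∘ p, ?_⟩
      have h1 : ((rootedIncidence ends A q).submatrix id p).mulVec (z ∘ p) =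
          (rootedIncidence ends A q).mulVec z := by
        ext v
        simp only [Matrix.mulVec, dotProduct, Matrix.submatrix_apply, id, Function.comp]
        refine Fintype.sum_of_injective p hp _ _ ?_ fun _ => rfl
        rintro (_ | e) ho
        · simp only [Finset.mem_image, Finset.mem_univ, true_and] at hnone
          exact absurd hnone ho
        · have : e ∉ T := fun he => ho ((hmem e).1 he)
          simp [hz, this]
      rw [h1, rootedIncidence_mulVec]
      have h2 : ∑ e ∈ A, z (some e) • edgeVec ends e = ∑ e ∈ T, a e • edgeVec ends e := by
        rw [← Finset.sum_subset hTA]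
        · exact Finset.sum_congr rfl fun e he => by simp [hz, show e ∈ T from he]
        · intro e _ he
          simp [hz, show e ∉ T from he]
      rw [h2, ← ha]
      simp [hz]
    have hunit := (Matrix.isUnit_iff_isUnit_det _).1 (Matrix.mulVec_surjective_iff_isUnit.1 hsurj)
    rcases Int.isUnit_iff.1 hunit with h | h <;> simp [h]
  · rw [sq_eq_zero_iff]
    by_cases hnone : none ∈ Finset.univ.image p
    swap
    · refine hzero (fun _ => 1) (fun h => by simpa using congrFun h q) fun v => ?_
      rcases hv : p v with _ | e
      · exact absurd (Finset.mem_image.2 ⟨v, Finset.mem_univ _, hv⟩) hnone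
      · by_cases he : e ∈ A
        · rw [vecMul_rootedIncidence_some q _ he, sub_self]
        · simp [rootedIncidence, he]
    by_cases hTA : T ⊆ A
    swap
    · obtain ⟨e, he, heA⟩ := Finset.not_subset.1 hTA
      obtain ⟨v, hv⟩ := (hmem e).1 he
      exact Matrix.det_eq_zero_of_column_eq_zero v fun w => by simp [hv, rootedIncidence, heA]
    have hconn : ¬ Conn ends T := fun hc => h ⟨hnone, hTA, hc⟩
    have hex : ∃ v, ¬ Linked ends T q v := by
      by_contra! hall
      exact hconn (conn_of_linked q hall)
    obtain ⟨v₀, hv₀⟩ := hex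
    refine hzero (fun v => if Linked ends T q v then 0 else 1)
      (fun h => by simpa [hv₀] using congrFun h v₀) fun v => ?_
    rcases hv : p v with _ | e
    · rw [vecMul_rootedIncidence_none]
      exact if_pos .refl
    · have he : e ∈ T := (hmem e).2 ⟨v, hv⟩
      rw [vecMul_rootedIncidence_some q _ (hTA he)]
      simp only [linked_iff_of_mem q he, sub_self]

lemma det_rootedLaplacian (A : Finset E) (q : V) :
    (rootedIncidence ends A q * (rootedIncidence ends A q).transpose).det =
      complexity ends A := by
  classical
  rw [det_mul_transpose_eq_card _
    (fun S => none ∈ S ∧ S.eraseNone ⊆ A ∧ Conn ends S.eraseNone)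
    (fun p hp => det_rootedIncidence_sq A q p hp), complexity, Nat.cast_inj,
    Nat.card_eq_fintype_card, Fintype.card_subtype]
  refine Finset.card_bij' (fun S _ => S.eraseNone) (fun T _ => T.insertNone) ?_ ?_ ?_ ?_
  · intro S hS
    simp only [Finset.mem_filter, Finset.mem_powersetCard, Finset.subset_univ, true_and] at hS
    obtain ⟨hcard, hnone, hSA, hconn⟩ := hS
    refine Finset.mem_filter.2 ⟨Finset.mem_univ _, hSA, hconn, ?_⟩
    rw [← hcard, ← Finset.card_insertNone, Finset.insertNone_eraseNone,
      Finset.insert_eq_self.2 hnone]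
  · intro T hT
    simp only [Finset.mem_filter, Finset.mem_univ, true_and] at hT
    obtain ⟨hTA, hconn, hcard⟩ := hT
    simp [Finset.mem_powersetCard, hTA, hconn, hcard]
  · intro S hS
    simp only [Finset.mem_filter] at hS
    rw [Finset.insertNone_eraseNone, Finset.insert_eq_self.2 hS.2.1]
  · intro T _
    exact Finset.eraseNone_insertNone T

lemma Conn.complexity_ne_zero {A : Finset E} (h : Conn ends A) : complexity ends A ≠ 0 := by
  obtain ⟨q⟩ := id h.1
  rw [← Nat.cast_ne_zero (R := ℤ), ← det_rootedLaplacian A q, Ne,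
    ← Matrix.exists_vecMul_eq_zero_iff]
  rintro ⟨f, hf, hzero⟩
  have h1 : Matrix.vecMul f (rootedIncidence ends A q) = 0 := by
    rw [← dotProduct_self_eq_zero]
    conv_lhs => rw [← Matrix.mulVec_transpose (rootedIncidence ends A q), Matrix.dotProduct_mulVec,
      Matrix.mulVec_transpose, Matrix.vecMul_vecMul, hzero, zero_dotProduct]
  refine hf (h.exists_edge f (q := q) ?_ fun e he => ?_)
  · rw [← vecMul_rootedIncidence_none A q f]
    exact congrFun h1 none
  · refine (sub_eq_zero.1 ?_).symm
    rw [← vecMul_rootedIncidence_some q f he]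
    exact congrFun h1 (some e)

/-- The twister group, enlarged by the multiples of the standard basis vector at a root. -/
def rootedTwGroup (ends : E → V × V) (A : Finset E) (q : V) : Submodule ℤ (V → ℤ) :=
  LinearMap.range
    (rootedIncidence ends A q * (rootedIncidence ends A q).transpose).mulVecLin

lemma mem_rootedTwGroup {A : Finset E} {q : V} {x : V → ℤ} (hx : ∑ v, x v = 0) :
    x ∈ rootedTwGroup ends A q ↔ x ∈ twGroup ends A := by
  have key : ∀ f : V → ℤ,
      (rootedIncidence ends A q * (rootedIncidence ends A q).transpose).mulVec f =
      f q • stdVec q + ∑ e ∈ A, (f (ends e).2 - f (ends e).1) • edgeVec ends e := by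
    intro f
    rw [← Matrix.mulVec_mulVec, rootedIncidence_mulVec, Matrix.mulVec_transpose]
    congr 1
    · rw [← vecMul_rootedIncidence_none A q f]
      rfl
    · refine Finset.sum_congr rfl fun e he => ?_
      rw [← vecMul_rootedIncidence_some q f he]
      rfl
  constructor
  · rintro ⟨f, rfl⟩
    rw [Matrix.mulVecLin_apply, key] at hx ⊢
    have hq : f q = 0 := by
      have := sum_eq_zero_of_mem_twGroup ends (laplacian_mem_twGroup ends A f)
      simp only [Pi.add_apply, Finset.sum_add_distrib, this] at hx
      simpa [← Finset.mul_sum, sum_stdVec] using hx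
    rw [hq, zero_smul, zero_add]
    exact laplacian_mem_twGroup ends A f
  · intro h
    obtain ⟨f, rfl⟩ := exists_laplacian_of_mem_twGroup ends h
    refine ⟨fun v => f v - f q, ?_⟩
    rw [Matrix.mulVecLin_apply, key]
    simp

/-- Kirchhoff's matrix tree theorem: the number of classes modulo twisters is the complexity. -/
lemma Conn.natCard_quotient {A : Finset E} (h : Conn ends A) (q : V) :
    Nat.card ((V → ℤ) ⧸ rootedTwGroup ends A q) = complexity ends A := by
  set M := rootedIncidence ends A q * (rootedIncidence ends A q).transpose with hM
  have hdet : M.det ≠ 0 := by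
    rw [det_rootedLaplacian]
    exact Nat.cast_ne_zero.2 h.complexity_ne_zero
  have hinj : Function.Injective M.mulVecLin := by
    rw [← LinearMap.ker_eq_bot, LinearMap.ker_eq_bot']
    intro f hf
    by_contra hne
    exact hdet (Matrix.exists_mulVec_eq_zero_iff.1 ⟨f, hne, hf⟩)
  have h1 := Submodule.natAbs_det_equiv (LinearMap.range M.mulVecLin)
    (LinearEquiv.ofInjective M.mulVecLin hinj)
  have h2 : (LinearMap.range M.mulVecLin).subtype ∘ₗ
      AddMonoidHom.toIntLinearMap
        (LinearEquiv.ofInjective M.mulVecLin hinj : (V → ℤ) →+ LinearMap.range M.mulVecLin) =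
      Matrix.toLin' M := by
    ext
    rfl
  rw [h2, LinearMap.det_toLin', det_rootedLaplacian, Int.natAbs_natCast] at h1
  exact h1.symm

/-- The class of a multidegree modulo twisters. -/
def degClass (ends : E → V × V) (A : Finset E) (q : V) (x : V → ℤ) :
    (V → ℤ) ⧸ rootedTwGroup ends A q := Submodule.Quotient.mk x

lemma degClass_eq_iff {A : Finset E} {q : V} {d : ℤ} {x y : V → ℤ} (hx : x ∈ Sdeg d A)
    (hy : y ∈ Sdeg d A) :
    degClass ends A q x = degClass ends A q y ↔ x - y ∈ twGroup ends A := by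
  rw [degClass, degClass, Submodule.Quotient.eq, mem_rootedTwGroup]
  rw [Finset.sum_congr rfl fun v _ => Pi.sub_apply x y v, Finset.sum_sub_distrib, hx.out, hy.out,
    sub_self]

lemma exists_degClass_eq (A : Finset E) (q : V) (d : ℤ)
    (c : (V → ℤ) ⧸ rootedTwGroup ends A q) : ∃ x ∈ Sdeg d A, degClass ends A q x = c := by
  obtain ⟨x, rfl⟩ := Submodule.Quotient.mk_surjective _ c
  set k := d - (nG A : ℤ) - ∑ v, x v with hk
  refine ⟨x + k • stdVec q, ?_, ?_⟩
  · simp [Sdeg, Finset.sum_add_distrib, ← Finset.mul_sum, sum_stdVec, hk]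
  · rw [degClass, Submodule.Quotient.eq, add_sub_cancel_left]
    refine Submodule.smul_mem _ _ ⟨fun _ => 1, ?_⟩
    rw [Matrix.mulVecLin_apply, ← Matrix.mulVec_mulVec, rootedIncidence_mulVec,
      Matrix.mulVec_transpose]
    have h1 : Matrix.vecMul (fun _ => 1) (rootedIncidence ends A q) none = 1 :=
      vecMul_rootedIncidence_none A q fun _ => 1
    have h2 : ∀ e ∈ A, Matrix.vecMul (fun _ => 1) (rootedIncidence ends A q) (some e) • edgeVec ends e
        = 0 := by
      intro e he
      have : Matrix.vecMul (fun _ => 1) (rootedIncidence ends A q) (some e) = 0 :=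
        (vecMul_rootedIncidence_some q (fun _ => 1) he).trans (sub_self _)
      rw [this, zero_smul]
    rw [h1, Finset.sum_eq_zero h2, one_smul, add_zero]

lemma IsRepSet.bijective_degClass {A : Finset E} {d : ℤ} {S : Set (V → ℤ)}
    (hS : IsRepSet ends d A S) (q : V) :
    Function.Bijective fun x : S => degClass ends A q x := by
  constructor
  · rintro ⟨x, hx⟩ ⟨y, hy⟩ hxy
    have h := (degClass_eq_iff (hS.1 hx) (hS.1 hy)).1 hxy
    have hx' : x - x ∈ twGroup ends A := by rw [sub_self]; exact zero_mem _
    exact Subtype.ext ((hS.2 x (hS.1 hx)).unique ⟨hx, hx'⟩ ⟨hy, h⟩)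
  · intro c
    obtain ⟨x, hx, rfl⟩ := exists_degClass_eq A q d c
    obtain ⟨y, ⟨hy, hxy⟩, -⟩ := hS.2 x hx
    exact ⟨⟨y, hy⟩, ((degClass_eq_iff hx (hS.1 hy)).2 hxy).symm⟩

lemma IsRepSet.natCard_eq {A : Finset E} {d : ℤ} {S : Set (V → ℤ)} (hA : Conn ends A)
    (hS : IsRepSet ends d A S) : Nat.card S = complexity ends A := by
  obtain ⟨q⟩ := id hA.1
  rw [← hA.natCard_quotient q]
  exact Nat.card_congr (Equiv.ofBijective _ (hS.bijective_degClass q))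

/-- A set of multidegrees meeting every class, of cardinality the complexity, is a minimal complete
set of representatives. -/
lemma isRepSet_of_natCard_eq {A : Finset E} {d : ℤ} {S : Set (V → ℤ)} (hA : Conn ends A)
    (hSd : S ⊆ Sdeg d A) (hcard : Nat.card S = complexity ends A)
    (hex : ∀ x ∈ Sdeg (E := E) d A, ∃ y ∈ S, x - y ∈ twGroup ends A) : IsRepSet ends d A S := by
  obtain ⟨q⟩ := id hA.1
  have hsurj : Function.Surjective fun x : S => degClass ends A q x := by
    intro c
    obtain ⟨x, hx, rfl⟩ := exists_degClass_eq A q d c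
    obtain ⟨y, hy, hxy⟩ := hex x hx
    exact ⟨⟨y, hy⟩, ((degClass_eq_iff hx (hSd hy)).2 hxy).symm⟩
  have : Finite S := Nat.finite_of_card_ne_zero (hcard ▸ hA.complexity_ne_zero)
  have hbij := hsurj.bijective_of_nat_card_le (by rw [hA.natCard_quotient q, hcard])
  refine ⟨hSd, fun x hx => ?_⟩
  obtain ⟨y, hy, hxy⟩ := hex x hx
  refine ⟨y, ⟨hy, hxy⟩, fun z ⟨hz, hxz⟩ => ?_⟩
  have : (⟨z, hz⟩ : S) = ⟨y, hy⟩ := hbij.1 <| by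
    show degClass ends A q z = degClass ends A q y
    rw [← (degClass_eq_iff hx (hSd hy)).2 hxy, ← (degClass_eq_iff hx (hSd hz)).2 hxz]
  exact congrArg Subtype.val this

end MatrixTree

section Subdivision

variable {ends : E → V × V}

/-- The exceptional vertex of `e` when every edge is subdivided once. -/
def midV (V : Type) (e : E) : SubV V E fun _ => 1 := Sum.inr ⟨e, (0 : Fin 1)⟩

/-- The two halves of `e` when every edge is subdivided once. -/
def half (e : E) (i : Fin 2) : SubE E fun _ => 1 := ⟨e, i⟩

lemma subEnds_half_zero (e : E) :
    subEnds ends (fun _ => 1) (half e 0) = (Sum.inl (ends e).1, midV V e) := by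
  simp [subEnds, half, subNode, midV]

lemma subEnds_half_one (e : E) :
    subEnds ends (fun _ => 1) (half e 1) = (midV V e, Sum.inl (ends e).2) := by
  simp [subEnds, half, subNode, midV]

lemma forall_subE {P : (SubE E fun _ => 1) → Prop} (h0 : ∀ e, P (half e 0))
    (h1 : ∀ e, P (half e 1)) : ∀ p, P p := by
  rintro ⟨e, i⟩
  change Fin 2 at i
  fin_cases i
  exacts [h0 e, h1 e]

lemma forall_subV {P : (SubV V E fun _ => 1) → Prop} (h0 : ∀ v, P (Sum.inl v))
    (h1 : ∀ e, P (midV V e)) : ∀ p, P p := by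
  rintro (v | ⟨e, i⟩)
  · exact h0 v
  · change Fin 1 at i
    fin_cases i
    exact h1 e

lemma Conn.subdivision (h : Conn ends (univ : Finset E)) :
    Conn (subEnds ends fun _ => 1) (univ : Finset (SubE E fun _ => 1)) := by
  obtain ⟨q⟩ := id h.1
  have key0 := fun e => linked_iff_of_mem (ends := subEnds ends fun _ => 1) (Sum.inl q)
    (mem_univ (half e 0))
  have key1 := fun e => linked_iff_of_mem (ends := subEnds ends fun _ => 1) (Sum.inl q)
    (mem_univ (half e 1))
  simp only [subEnds_half_zero, subEnds_half_one] at key0 key1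
  have hv : ∀ v, Linked (subEnds ends fun _ => 1) univ (Sum.inl q) (Sum.inl v) := fun v =>
    (h.2 q v).induct (P := fun w => Linked (subEnds ends fun _ => 1) univ (Sum.inl q) (Sum.inl w))
      (fun e _ => (key0 e).trans (key1 e)) .refl
  exact conn_of_linked (Sum.inl q) (forall_subV hv fun e => (key0 e).1 (hv _))

lemma Conn.half_mem {T : Finset (SubE E fun _ => 1)} (hV : Nonempty V)
    (hT : Conn (subEnds ends fun _ => 1) T) (e : E) : half e 0 ∈ T ∨ half e 1 ∈ T := by
  by_contra! hne
  obtain ⟨q⟩ := hV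
  refine absurd ((hT.2 (midV V e) (Sum.inl q)).induct (P := fun x => x = midV V e) ?_ rfl)
    Sum.inl_ne_inr
  · refine forall_subE (fun f hf => ?_) fun f hf => ?_
    · rw [subEnds_half_zero]
      have : f ≠ e := fun h => hne.1 (h ▸ hf)
      simp [midV, this]
    · rw [subEnds_half_one]
      have : f ≠ e := fun h => hne.2 (h ▸ hf)
      simp [midV, this]

/-- The edges of the original graph both of whose halves belong to `T`. -/
def wholeEdges (T : Finset (SubE E fun _ => 1)) : Finset E :=
  univ.filter fun e => half e 0 ∈ T ∧ half e 1 ∈ T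

/-- The edges of the original graph whose first half belongs to `T`. -/
def firstEdges (T : Finset (SubE E fun _ => 1)) : Finset E :=
  univ.filter fun e => half e 0 ∈ T

lemma Conn.wholeEdges {T : Finset (SubE E fun _ => 1)} (hV : Nonempty V)
    (hT : Conn (subEnds ends fun _ => 1) T) : Conn ends (wholeEdges T) := by
  obtain ⟨q⟩ := id hV
  refine conn_of_linked q fun v => ?_
  refine (hT.2 (Sum.inl q) (Sum.inl v)).induct (P := fun x => Linked ends (_root_.wholeEdges T) q
    (Sum.elim id (fun p => if half p.1 0 ∈ T then (ends p.1).1 else (ends p.1).2) x)) ?_ .refl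
  refine forall_subE (fun f hf => ?_) fun f hf => ?_
  · rw [subEnds_half_zero]
    simp [midV, hf]
  · rw [subEnds_half_one]
    by_cases h0 : half f 0 ∈ T
    · simpa [midV, h0] using linked_iff_of_mem q
        (show f ∈ _root_.wholeEdges T by simp [_root_.wholeEdges, h0, hf])
    · simp [midV, h0]

lemma card_eq_card_wholeEdges {T : Finset (SubE E fun _ => 1)}
    (hT : ∀ e, half e 0 ∈ T ∨ half e 1 ∈ T) :
    T.card = Fintype.card E + (wholeEdges T).card := by
  have h1 : T.card = ∑ p, if p ∈ T then 1 else 0 := by simp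
  rw [h1, Fintype.sum_sigma, wholeEdges, card_filter, ← card_univ, card_eq_sum_ones,
    ← sum_add_distrib]
  refine sum_congr rfl fun e _ => ?_
  change ∑ i : Fin 2, (if half e i ∈ T then 1 else 0) = _
  rw [Fin.sum_univ_two]
  have := hT e
  split_ifs <;> tauto

lemma IsSpanningTree.wholeEdges {T : Finset (SubE E fun _ => 1)} (hV : Nonempty V)
    (hT : IsSpanningTree (subEnds ends fun _ => 1) T) : IsSpanningTree ends (wholeEdges T) := by
  refine ⟨hT.1.wholeEdges hV, ?_⟩
  have h := hT.2
  rw [card_eq_card_wholeEdges (hT.1.half_mem hV)] at h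
  simp only [Fintype.card_sum, Fintype.card_sigma, Fintype.card_fin, sum_const, card_univ,
    smul_eq_mul, mul_one] at h
  omega

lemma complexity_subdivision_le (hV : Nonempty V) :
    complexity (subEnds ends fun _ => 1) (univ : Finset (SubE E fun _ => 1)) ≤
      ∑ A : Finset E, complexity ends A := by
  simp only [complexity]
  rw [← Nat.card_sigma]
  refine Nat.card_le_card_of_injective (fun T => ⟨firstEdges T.1, wholeEdges T.1,
    fun e he => ?_, T.2.2.wholeEdges hV⟩) ?_
  · simp only [wholeEdges, firstEdges, mem_filter, mem_univ, true_and] at he ⊢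
    exact he.1
  · rintro ⟨T, hT⟩ ⟨T', hT'⟩ h
    have h1 : firstEdges T = firstEdges T' := congrArg Sigma.fst h
    have h2 : wholeEdges T = wholeEdges T' := congrArg (fun p => p.2.1) h
    simp only [Finset.ext_iff, firstEdges, wholeEdges, mem_filter, mem_univ, true_and] at h1 h2
    refine Subtype.ext (Finset.ext (forall_subE h1 fun e => ?_))
    have := hT.2.1.half_mem hV e
    have := hT'.2.1.half_mem hV e
    have := h1 e
    have := h2 e
    tauto

/-- An assignment with enough elements whose lift is a set of representatives has exactly as many
elements as there are spanning trees. -/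
lemma natCard_eq_complexity {d : ℤ} {σ : Finset E → Set (V → ℤ)}
    (hconn : Conn ends (univ : Finset E))
    (hcard : ∀ G : Finset E, Conn ends G → (complexity ends G : ℕ∞) ≤ (σ G).encard)
    (hlift : IsRepSet (subEnds ends fun _ => 1) d
      (univ : Finset (SubE E fun _ => 1)) (liftSet (fun _ => 1) σ)) {G : Finset E} :
    Nat.card (σ G) = complexity ends G := by
  have hcard' : ∀ A, (complexity ends A : ℕ∞) ≤ (σ A).encard := by
    intro A
    by_cases hA : Conn ends A
    · exact hcard A hA
    · have : complexity ends A = 0 := by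
        rw [complexity, Nat.card_eq_zero]
        exact Or.inl ⟨fun T => hA (T.2.2.1.mono T.2.1)⟩
      simp [this]
  have hnat := hlift.natCard_eq hconn.subdivision
  have hfin : Finite (liftSet (fun _ => 1) σ) :=
    Nat.finite_of_card_ne_zero (hnat ▸ hconn.subdivision.complexity_ne_zero)
  let ι : (Σ A, σ A) → liftSet (fun _ => 1) σ := fun p =>
    ⟨liftOf (fun _ => 1) p.1 p.2.1 0, p.1, p.2.1, 0, p.2.2, by simp, rfl⟩
  have hι : Function.Injective ι := by
    rintro ⟨A, x, hx⟩ ⟨B, y, hy⟩ h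
    have h' : liftOf (fun _ => 1) A x 0 = liftOf (fun _ => 1) B y 0 := congrArg Subtype.val h
    obtain rfl : A = B := by
      ext e
      have he := congrFun h' (midV V e)
      simp only [liftOf, midV, Sum.elim_inr, Pi.zero_apply] at he
      by_cases h1 : e ∈ A <;> by_cases h2 : e ∈ B <;> simp_all
    obtain rfl : x = y := funext fun v => congrFun h' (Sum.inl v)
    rfl
  have hfinσ : Finite (Σ A, σ A) := Finite.of_injective ι hι
  have hfinA : ∀ A, Finite (σ A) := fun A =>
    Finite.of_injective (fun x : σ A => (⟨A, x⟩ : Σ A, σ A)) fun x y h => by simpa using h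
  have hle : ∀ A, complexity ends A ≤ Nat.card (σ A) := by
    intro A
    have h := hcard' A
    rw [← (Set.toFinite (σ A)).cast_ncard_eq] at h
    exact_mod_cast h
  have hsum : ∑ A, Nat.card (σ A) ≤ ∑ A, complexity ends A := by
    rw [← Nat.card_sigma]
    exact (Nat.card_le_card_of_injective ι hι).trans
      (hnat ▸ complexity_subdivision_le hconn.1)
  exact ((sum_eq_sum_iff_of_le fun A _ => hle A).1
    ((sum_le_sum fun A _ => hle A).antisymm hsum) G (mem_univ _)).symm

end Subdivision

section Flows

variable (ends : E → V × V)

/-- An integral circulation: a combination of edges with zero boundary. -/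
def IsFlow (c : E → ℤ) : Prop := ∑ e, c e • edgeVec ends e = 0

/-- The indicator function of the component of the head of `f` after deletion of `f`. -/
noncomputable def headSide (T : Finset E) (f : E) (v : V) : ℤ :=
  open Classical in if Linked ends (T.erase f) (ends f).2 v then 1 else 0

/-- The signed incidence of `e` with the cut that `f` defines in the tree `T`. -/
noncomputable def cross (T : Finset E) (f e : E) : ℤ :=
  headSide ends T f (ends e).2 - headSide ends T f (ends e).1

/-- The fundamental circulation of an edge `e` with respect to the tree `T`. -/
noncomputable def fundFlow (T : Finset E) (e : E) : E → ℤ := fun f =>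
  (if f = e then 1 else 0) - if f ∈ T then cross ends T f e else 0

variable {ends}

lemma abs_cross_le (T : Finset E) (f e : E) : |cross ends T f e| ≤ 1 := by
  rw [cross, headSide, headSide]
  split_ifs <;> simp

lemma cross_eq_zero {T : Finset E} {f g : E} (hg : g ∈ T) (hne : g ≠ f) :
    cross ends T f g = 0 := by
  have h := linked_iff_of_mem (ends := ends) (ends f).2 (mem_erase.2 ⟨hne, hg⟩)
  unfold cross headSide
  rw [propext h, sub_self]

lemma cross_self_of_not_linked {T : Finset E} {f : E}
    (hf : ¬ Linked ends (T.erase f) (ends f).2 (ends f).1) : cross ends T f f = 1 := by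
  rw [cross, headSide, headSide, if_pos .refl, if_neg hf, sub_zero]

lemma IsSpanningTree.not_linked {T : Finset E} (hT : IsSpanningTree ends T) {f : E} (hf : f ∈ T) :
    ¬ Linked ends (T.erase f) (ends f).2 (ends f).1 := by
  intro h
  have h1 := (hT.1.erase h).card_le
  have h2 := hT.2
  have h3 := card_erase_add_one hf
  omega

lemma IsSpanningTree.cross_self {T : Finset E} (hT : IsSpanningTree ends T) {f : E} (hf : f ∈ T) :
    cross ends T f f = 1 :=
  cross_self_of_not_linked (hT.not_linked hf)

lemma IsSpanningTree.cross_eq {T : Finset E} (hT : IsSpanningTree ends T) {f g : E} (hf : f ∈ T)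
    (hg : g ∈ T) : cross ends T f g = if g = f then 1 else 0 := by
  split_ifs with h
  · rw [h, hT.cross_self hf]
  · exact cross_eq_zero hg h

/-- Pairing a combination of tree edges with a fundamental cut extracts a coefficient. -/
lemma IsSpanningTree.sum_headSide_mul {T : Finset E} (hT : IsSpanningTree ends T) (a : E → ℤ)
    {f : E} (hf : f ∈ T) :
    ∑ v, headSide ends T f v * (∑ e ∈ T, a e • edgeVec ends e) v = a f := by
  rw [sum_mul_sum_edgeVec]
  calc _ = ∑ e ∈ T, a e * (if e = f then 1 else 0) :=
        sum_congr rfl fun e he => by rw [← hT.cross_eq hf he, cross]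
    _ = a f := by simp [hf]

lemma IsSpanningTree.edgeVec_eq {T : Finset E} (hT : IsSpanningTree ends T) (e : E) :
    edgeVec ends e = ∑ f ∈ T, cross ends T f e • edgeVec ends f := by
  obtain ⟨a, ha⟩ := hT.1.exists_edgeVec_sum (sum_edgeVec ends e)
  rw [ha]
  refine sum_congr rfl fun f hf => ?_
  rw [← hT.sum_headSide_mul a hf, ← ha, sum_mul_edgeVec, cross]

lemma IsSpanningTree.isFlow_fundFlow {T : Finset E} (hT : IsSpanningTree ends T) (e : E) :
    IsFlow ends (fundFlow ends T e) := by
  simp only [IsFlow, fundFlow, sub_smul, ite_smul, one_smul, zero_smul, sum_sub_distrib,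
    sum_ite_eq', mem_univ, if_true, ← sum_filter, filter_mem_eq_inter, univ_inter]
  rw [← hT.edgeVec_eq, sub_self]

lemma fundFlow_self {T : Finset E} {e : E} (he : e ∉ T) : fundFlow ends T e e = 1 := by
  simp [fundFlow, he]

lemma fundFlow_of_notMem {T : Finset E} {e f : E} (hf : f ∉ T) :
    fundFlow ends T e f = if f = e then 1 else 0 := by
  simp [fundFlow, hf]

lemma fundFlow_of_mem {T : Finset E} {e f : E} (he : e ∉ T) (hf : f ∈ T) :
    fundFlow ends T e f = -cross ends T f e := by
  have : f ≠ e := fun h => he (h ▸ hf)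
  simp [fundFlow, hf, this]

lemma abs_fundFlow_le {T : Finset E} {e : E} (he : e ∉ T) (f : E) :
    |fundFlow ends T e f| ≤ 1 := by
  by_cases hf : f ∈ T
  · rw [fundFlow_of_mem he hf, abs_neg]
    exact abs_cross_le T f e
  · rw [fundFlow_of_notMem hf]
    split_ifs <;> simp

lemma IsFlow.sum_eq {c : E → ℤ} (hc : IsFlow ends c) : ∑ e, c e • edgeVec ends e = 0 := hc

lemma IsFlow.sub {b c : E → ℤ} (hb : IsFlow ends b) (hc : IsFlow ends c) :
    IsFlow ends (b - c) := by
  simp only [IsFlow, Pi.sub_apply, sub_smul, sum_sub_distrib, hb.sum_eq, hc.sum_eq, sub_zero]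

lemma IsFlow.smul {c : E → ℤ} (hc : IsFlow ends c) (k : ℤ) : IsFlow ends (k • c) := by
  simp only [IsFlow, Pi.smul_apply, smul_assoc, ← smul_sum, hc.sum_eq, smul_zero]

lemma IsFlow.eq_zero {c : E → ℤ} (hc : IsFlow ends c) {T : Finset E} (hT : IsSpanningTree ends T)
    (hcT : ∀ f ∉ T, c f = 0) : c = 0 := by
  have h : ∑ e ∈ T, c e • edgeVec ends e = 0 := by
    rw [← hc.sum_eq]
    exact sum_subset (subset_univ _) fun f _ hf => by rw [hcT f hf, zero_smul]
  ext f
  by_cases hf : f ∈ T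
  · rw [← hT.sum_headSide_mul c hf, h]
    simp
  · exact hcT f hf

/-- The circulations on a tree plus one edge are the multiples of the fundamental one. -/
lemma IsFlow.eq_smul_fundFlow {c : E → ℤ} (hc : IsFlow ends c) {T : Finset E}
    (hT : IsSpanningTree ends T) {e : E} (he : e ∉ T) (hcT : ∀ f ∉ T, f ≠ e → c f = 0) :
    c = c e • fundFlow ends T e := by
  refine sub_eq_zero.1 ((hc.sub ((hT.isFlow_fundFlow e).smul (c e))).eq_zero hT fun f hf => ?_)
  by_cases hfe : f = e
  · subst hfe
    simp [fundFlow_self he]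
  · simp [fundFlow_of_notMem hf, hfe, hcT f hf hfe]

/-- Deleting an edge of a circulation keeps a graph connected. -/
lemma IsFlow.conn_erase {c : E → ℤ} (hc : IsFlow ends c) {U : Finset E} (hU : Conn ends U)
    (hcU : ∀ f ∉ U, c f = 0) {e : E} (he : c e ≠ 0) : Conn ends (U.erase e) := by
  refine hU.erase ?_
  by_contra hne
  have h := sum_mul_sum_edgeVec ends (headSide ends U e) univ c
  rw [hc.sum_eq] at h
  simp only [Pi.zero_apply, mul_zero, sum_const_zero] at h
  rw [sum_eq_single e] at h
  · rw [← cross, cross_self_of_not_linked hne, mul_one] at h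
    exact he h.symm
  · intro f _ hf
    by_cases hfU : f ∈ U
    · exact mul_eq_zero_of_right _ (cross_eq_zero (ends := ends) hfU hf)
    · rw [hcU f hfU, zero_mul]
  · simp

end Flows

/-- Equally many differences of coordinates as coordinates satisfy a linear relation. -/
lemma exists_relation_sub {ι κ : Type*} [Fintype ι] [Fintype κ] [DecidableEq κ] [Nonempty κ]
    (hcard : Fintype.card ι = Fintype.card κ) (p q : ι → κ) :
    ∃ a : ι → ℚ, a ≠ 0 ∧ ∀ h : κ → ℚ, ∑ i, a i * (h (p i) - h (q i)) = 0 := by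
  let M : Matrix κ ι ℚ :=
    Matrix.of fun k i => (if p i = k then 1 else 0) - if q i = k then 1 else 0
  have key : ∀ (a : ι → ℚ) (h : κ → ℚ),
      ∑ k, h k * M.mulVecLin a k = ∑ i, a i * (h (p i) - h (q i)) := by
    intro a h
    simp only [Matrix.mulVecLin_apply, Matrix.mulVec, dotProduct, mul_sum, M,
      Matrix.of_apply]
    rw [sum_comm]
    refine sum_congr rfl fun i _ => ?_
    rw [show h (p i) - h (q i) = ∑ k, h k * ((if p i = k then 1 else 0) - if q i = k then 1 else 0)
      by simp [mul_sub], mul_sum]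
    exact sum_congr rfl fun k _ => by ring
  have hns : ¬ Function.Injective M.mulVecLin := by
    rw [LinearMap.injective_iff_surjective_of_finrank_eq_finrank (by simpa using hcard)]
    intro hsurj
    obtain ⟨k⟩ := ‹Nonempty κ›
    obtain ⟨a, ha⟩ := hsurj (Pi.single k 1)
    have h := key a 1
    rw [ha] at h
    simp at h
  rw [← LinearMap.ker_eq_bot, LinearMap.ker_eq_bot'] at hns
  push Not at hns
  obtain ⟨a, ha, hne⟩ := hns
  refine ⟨a, hne, fun h => ?_⟩
  rw [← key, ha]
  simp

section CycleRelation

variable {ends : E → V × V}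

lemma IsSpanningTree.card_insert {T : Finset E} (hT : IsSpanningTree ends T) {e : E}
    (he : e ∉ T) : (insert e T).card = Fintype.card V := by
  rw [card_insert_of_notMem he, hT.2]

lemma Conn.isSpanningTree_erase {U : Finset E} (hU : U.card = Fintype.card V) {e : E}
    (he : e ∈ U) (h : Conn ends (U.erase e)) : IsSpanningTree ends (U.erase e) :=
  ⟨h, by rw [card_erase_add_one he, hU]⟩

lemma IsFlow.mem_of_ne_zero {c : E → ℤ} {U : Finset E} (hcU : ∀ f ∉ U, c f = 0) {e : E}
    (he : c e ≠ 0) : e ∈ U := by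
  by_contra h
  exact he (hcU e h)

lemma mul_self_of_abs_le_one {k : ℤ} (hk : |k| ≤ 1) (h0 : k ≠ 0) : k * k = 1 := by
  obtain ⟨h1, h2⟩ := abs_le.1 hk
  obtain rfl | rfl : k = 1 ∨ k = -1 := by omega
  all_goals rfl

/-- In a graph with a single cycle, the spanning trees are the complements of the edges of the
cycle. -/
lemma IsFlow.complexity_eq {c : E → ℤ} (hc : IsFlow ends c) (hc0 : c ≠ 0) {U : Finset E}
    (hU : Conn ends U) (hUc : U.card = Fintype.card V) (hcU : ∀ f ∉ U, c f = 0) :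
    complexity ends U = Fintype.card {e // c e ≠ 0} := by
  rw [complexity, ← Nat.card_eq_fintype_card]
  refine (Nat.card_congr (Equiv.ofBijective (fun e : {e // c e ≠ 0} => ⟨U.erase e,
    erase_subset _ _, (hc.conn_erase hU hcU e.2).isSpanningTree_erase hUc
      (mem_of_ne_zero hcU e.2)⟩) ⟨?_, ?_⟩)).symm
  · rintro ⟨e, he⟩ ⟨f, hf⟩ h
    exact Subtype.ext (erase_injOn U (mem_of_ne_zero hcU he) (mem_of_ne_zero hcU hf)
      (congrArg Subtype.val h))
  · rintro ⟨T, hTU, hT⟩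
    obtain ⟨e, he, rfl⟩ := exists_eq_insert_iff.2 ⟨hTU, hT.2.trans hUc.symm⟩
    refine ⟨⟨e, fun h0 => hc0 ?_⟩, Subtype.ext (erase_insert he)⟩
    rw [hc.eq_smul_fundFlow hT he fun f hf hfe => hcU f (by simp [hf, hfe]), h0, zero_smul]

/-- The multidegrees `x` chosen on spanning trees satisfy a linear relation for every cycle. -/
def CycleRelation (ends : E → V × V) (x : Finset E → V → ℤ) : Prop :=
  ∀ (U : Finset E) (c : E → ℤ), Conn ends U → U.card = Fintype.card V → IsFlow ends c → c ≠ 0 →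
    (∀ f ∉ U, c f = 0) → (∀ f, |c f| ≤ 1) → ∀ h : (V → ℤ) → ℚ,
      ∑ e, (c e : ℚ) * (h (x (U.erase e) + stdVec (ends e).2) -
        h (x (U.erase e) + stdVec (ends e).1)) = 0

lemma ChipAdding.cycleRelation {σ : Finset E → Set (V → ℤ)} (hchip : ChipAdding ends σ)
    (hσ : ∀ G, Nat.card (σ G) = complexity ends G) {x : Finset E → V → ℤ}
    (hx : ∀ T, IsSpanningTree ends T → x T ∈ σ T) : CycleRelation ends x := by
  intro U c hU hUc hc hc0 hcU hc1 h
  have hcard : Nat.card (σ U) ≠ 0 := by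
    rw [hσ]
    exact hU.complexity_ne_zero
  have : Finite (σ U) := Nat.finite_of_card_ne_zero hcard
  have : Nonempty (σ U) := (Nat.card_ne_zero.1 hcard).1
  have := Fintype.ofFinite (σ U)
  have hmem : ∀ e, c e ≠ 0 → ∀ v ∈ eSym ends e, x (U.erase e) + stdVec v ∈ σ U := by
    intro e he v hv
    have heU := IsFlow.mem_of_ne_zero hcU he
    simpa [insert_erase heU] using hchip _ _
      (hx _ ((hc.conn_erase hU hcU he).isSpanningTree_erase hUc heU)) e (notMem_erase e U) v hv
  obtain ⟨a, ha0, ha⟩ := exists_relation_sub (ι := {e // c e ≠ 0}) (κ := σ U)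
    (by rw [← Nat.card_eq_fintype_card (α := σ U), hσ, hc.complexity_eq hc0 hU hUc hcU])
    (fun e => ⟨_, hmem e e.2 (ends e).2 (Sym2.mem_mk_right _ _)⟩)
    (fun e => ⟨_, hmem e e.2 (ends e).1 (Sym2.mem_mk_left _ _)⟩)
  obtain ⟨⟨e₀, he₀⟩, hae₀⟩ := Function.ne_iff.1 ha0
  have heU := IsFlow.mem_of_ne_zero hcU he₀
  set T := U.erase e₀
  have hTree : IsSpanningTree ends T := (hc.conn_erase hU hcU he₀).isSpanningTree_erase hUc heU
  have heT : e₀ ∉ T := notMem_erase e₀ U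
  have hcT := hc.eq_smul_fundFlow hTree heT fun f hf hfe =>
    hcU f fun hfU => hf (mem_erase.2 ⟨hfe, hfU⟩)
  have hprop : ∀ e : {e // c e ≠ 0}, a e = a ⟨e₀, he₀⟩ * c e₀ * c e := by
    rintro ⟨g, hg⟩
    have hsq : (c e₀ : ℚ) * c e₀ = 1 := by exact_mod_cast mul_self_of_abs_le_one (hc1 e₀) he₀
    by_cases hge : g = e₀
    · subst hge
      rw [mul_assoc, hsq, mul_one]
    have hgT : g ∈ T := mem_erase.2 ⟨hge, IsFlow.mem_of_ne_zero hcU hg⟩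
    have h1 := ha fun y => ((∑ v, headSide ends T g v * y.1 v : ℤ) : ℚ)
    have h2 : ∀ e : {e // c e ≠ 0},
        ((∑ v, headSide ends T g v * (x (U.erase e.1) + stdVec (ends e.1).2) v : ℤ) : ℚ) -
          (∑ v, headSide ends T g v * (x (U.erase e.1) + stdVec (ends e.1).1) v : ℤ) =
        (if e = ⟨g, hg⟩ then 1 else 0) +
          if e = ⟨e₀, he₀⟩ then (cross ends T g e₀ : ℚ) else 0 := by
      rintro ⟨e, he⟩
      rw [← Int.cast_sub, ← sum_sub_distrib]
      have : ∑ v, (headSide ends T g v * (x (U.erase e) + stdVec (ends e).2) v -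
          headSide ends T g v * (x (U.erase e) + stdVec (ends e).1) v) = cross ends T g e := by
        rw [cross, ← sum_mul_edgeVec]
        refine sum_congr rfl fun v _ => ?_
        simp only [Pi.add_apply, edgeVec, Pi.sub_apply]
        ring
      rw [this]
      by_cases hee : e = e₀
      · subst hee
        simp [Ne.symm hge]
      · have heT' : e ∈ T := mem_erase.2 ⟨hee, IsFlow.mem_of_ne_zero hcU he⟩
        rw [hTree.cross_eq hgT heT']
        simp [hee]
    simp only [h2, mul_add, sum_add_distrib, mul_ite, mul_one, mul_zero, sum_ite_eq', mem_univ,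
      if_true] at h1
    have h3 : (c g : ℚ) = c e₀ * -cross ends T g e₀ := by
      have := congrFun hcT g
      rw [Pi.smul_apply, fundFlow_of_mem heT hgT, smul_eq_mul] at this
      exact_mod_cast this
    rw [h3]
    linear_combination h1 + a ⟨e₀, he₀⟩ * cross ends T g e₀ * hsq
  have h1 := ha fun y => h y.1
  rw [sum_congr rfl fun e _ => congrArg (· * _) (hprop e)] at h1
  simp only [mul_assoc, ← mul_sum] at h1
  have h2 := (mul_eq_zero.1 ((mul_eq_zero.1 h1).resolve_left hae₀)).resolve_left
    (by exact_mod_cast he₀)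
  rw [← h2, ← sum_filter_of_ne (p := fun e => c e ≠ 0)]
  · exact sum_subtype _ (by simp) _
  · intro e _ he h0
    simp [h0] at he

end CycleRelation

section WallCrossing

variable (ends : E → V × V)

open Classical in
/-- The spanning trees contained in `A`. -/
noncomputable def treesIn (A : Finset E) : Finset (Finset E) :=
  A.powerset.filter fun T => IsSpanningTree ends T

/-- The end of `e` on which the covector `θ` puts a chip when `e` is added to the tree `T`. -/
noncomputable def chosenEnd (θ : E → ℤ) (T : Finset E) (e : E) : V :=
  if 0 < θ ⬝ᵥ fundFlow ends T e then (ends e).2 else (ends e).1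

/-- The multidegree on `A` obtained from the one on the tree `T` by adding chips as prescribed by
the covector `θ`. -/
noncomputable def treeTerm (x : Finset E → V → ℤ) (A : Finset E) (θ : E → ℤ) (T : Finset E) :
    V → ℤ :=
  x T + ∑ e ∈ A \ T, stdVec (chosenEnd ends θ T e)

variable {ends}

lemma mem_treesIn {A T : Finset E} : T ∈ treesIn ends A ↔ T ⊆ A ∧ IsSpanningTree ends T := by
  simp [treesIn]

lemma chosenEnd_congr {θ θ' : E → ℤ} {T T' : Finset E} {e : E}
    (h : 0 < θ ⬝ᵥ fundFlow ends T e ↔ 0 < θ' ⬝ᵥ fundFlow ends T' e) :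
    chosenEnd ends θ T e = chosenEnd ends θ' T' e := by
  simp only [chosenEnd, h]

lemma treeTerm_congr (x : Finset E → V → ℤ) {A : Finset E} {θ θ' : E → ℤ} {T : Finset E}
    (h : ∀ e ∈ A \ T, 0 < θ ⬝ᵥ fundFlow ends T e ↔ 0 < θ' ⬝ᵥ fundFlow ends T e) :
    treeTerm ends x A θ T = treeTerm ends x A θ' T := by
  rw [treeTerm, treeTerm, sum_congr rfl fun e he => by rw [chosenEnd_congr (h e he)]]

lemma ChipAdding.add_sum_mem {σ : Finset E → Set (V → ℤ)} (hchip : ChipAdding ends σ)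
    {T : Finset E} {y : V → ℤ} (hy : y ∈ σ T) (t : E → V) (B : Finset E) (hB : Disjoint B T)
    (ht : ∀ e ∈ B, t e ∈ eSym ends e) : y + ∑ e ∈ B, stdVec (t e) ∈ σ (B ∪ T) := by
  induction B using Finset.induction_on with
  | empty => simpa using hy
  | insert e B he ih =>
    rw [disjoint_insert_left] at hB
    rw [sum_insert he, add_comm (stdVec _), ← add_assoc, insert_union]
    exact hchip _ _ (ih hB.2 fun f hf => ht f (mem_insert_of_mem hf)) e
      (by simp [he, hB.1]) _ (ht e (mem_insert_self _ _))

lemma ChipAdding.treeTerm_mem {σ : Finset E → Set (V → ℤ)} (hchip : ChipAdding ends σ)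
    {x : Finset E → V → ℤ} (hx : ∀ T, IsSpanningTree ends T → x T ∈ σ T) {A T : Finset E}
    (hT : T ∈ treesIn ends A) (θ : E → ℤ) : treeTerm ends x A θ T ∈ σ A := by
  rw [mem_treesIn] at hT
  have h := hchip.add_sum_mem (hx T hT.2) (chosenEnd ends θ T) (A \ T) sdiff_disjoint fun e _ => by
    rw [chosenEnd]
    split_ifs
    exacts [Sym2.mem_mk_right _ _, Sym2.mem_mk_left _ _]
  rwa [sdiff_union_of_subset hT.1] at h

/-- Crossing the wall defined by the cycle `c` preserves the multiset of multidegrees obtained from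
spanning trees. -/
lemma CycleRelation.sum_treeTerm_eq {x : Finset E → V → ℤ} (hx : CycleRelation ends x)
    {A : Finset E} {c θ θpos θneg : E → ℤ} (hc : IsFlow ends c) (hc1 : ∀ f, |c f| ≤ 1)
    (hθ : θ ⬝ᵥ c = 0) (hpos : 0 < θpos ⬝ᵥ c) (hneg : θneg ⬝ᵥ c < 0)
    (hwall : ∀ T ∈ treesIn ends A, ∀ e ∈ A \ T, (∃ k : ℤ, fundFlow ends T e = k • c) ∨
      (0 < θpos ⬝ᵥ fundFlow ends T e ↔ 0 < θ ⬝ᵥ fundFlow ends T e) ∧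
      (0 < θneg ⬝ᵥ fundFlow ends T e ↔ 0 < θ ⬝ᵥ fundFlow ends T e))
    (h : (V → ℤ) → ℚ) :
    ∑ T ∈ treesIn ends A, h (treeTerm ends x A θpos T) =
      ∑ T ∈ treesIn ends A, h (treeTerm ends x A θneg T) := by
  rw [← sub_eq_zero, ← sum_sub_distrib]
  set C : Finset E := univ.filter fun e => c e ≠ 0 with hC
  have hmemC : ∀ e, e ∈ C ↔ c e ≠ 0 := by simp [hC]
  have hc0 : c ≠ 0 := by
    rintro rfl
    simp at hpos
  rw [← sum_fiberwise_of_maps_to (g := fun T => T ∪ C) (t := univ) fun _ _ => mem_univ _]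
  refine sum_eq_zero fun U _ => ?_
  by_cases hbad : ∃ T ∈ treesIn ends A, T ∪ C = U ∧ ∃ e ∈ A \ T, ∃ k : ℤ,
      fundFlow ends T e = k • c
  swap
  · push Not at hbad
    refine sum_eq_zero fun T hT => ?_
    rw [mem_filter] at hT
    rw [sub_eq_zero, treeTerm_congr x fun e he => ?_]
    obtain ⟨k, hk⟩ | ⟨h1, h2⟩ := hwall T hT.1 e he
    · exact absurd hk (hbad T hT.1 hT.2 e he k)
    · rw [h1, h2]
  obtain ⟨T, hTA, rfl, e, he, k, hk⟩ := hbad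
  obtain ⟨hTA, hT⟩ := mem_treesIn.1 hTA
  obtain ⟨heA, heT⟩ := mem_sdiff.1 he
  have hke : k * c e = 1 := by
    rw [← smul_eq_mul, ← Pi.smul_apply, ← hk, fundFlow_self heT]
  have hk0 : k ≠ 0 := left_ne_zero_of_mul_eq_one hke
  have hU : T ∪ C = insert e T := by
    ext f
    rw [mem_union, mem_insert, hmemC]
    by_cases hfT : f ∈ T
    · simp [hfT]
    have h1 := congrFun hk f
    rw [fundFlow_of_notMem hfT, Pi.smul_apply, smul_eq_mul] at h1
    split_ifs at h1 with hfe
    · subst hfe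
      simp [right_ne_zero_of_mul_eq_one hke]
    · simp only [hfT, hfe, false_or, iff_false, not_not]
      exact (mul_eq_zero.1 h1.symm).resolve_left hk0
  rw [hU]
  set U := insert e T with hUdef
  have hUA : U ⊆ A := insert_subset heA hTA
  have hUconn : Conn ends U := hT.1.mono (subset_insert _ _)
  have hUcard : U.card = Fintype.card V := hT.card_insert heT
  have hcU : ∀ f ∉ U, c f = 0 := by
    intro f hf
    by_contra h0
    exact hf (hU ▸ mem_union_right T ((hmemC f).2 h0))
  have htree : ∀ f ∈ C, IsSpanningTree ends (U.erase f) := fun f hf =>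
    (hc.conn_erase hUconn hcU ((hmemC f).1 hf)).isSpanningTree_erase hUcard
      (IsFlow.mem_of_ne_zero hcU ((hmemC f).1 hf))
  have hmul : ∀ f ∈ C, ∀ b, IsFlow ends b → (∀ g ∉ U, b g = 0) → b = (b f * c f) • c := by
    intro f hf b hb hbU
    have key : ∀ b, IsFlow ends b → (∀ g ∉ U, b g = 0) →
        b = b f • fundFlow ends (U.erase f) f := fun b hb hbU =>
      hb.eq_smul_fundFlow (htree f hf) (notMem_erase f U) fun g hg hgf =>
        hbU g fun hgU => hg (mem_erase.2 ⟨hgf, hgU⟩)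
    calc b = b f • fundFlow ends (U.erase f) f := key b hb hbU
      _ = (b f * c f) • c f • fundFlow ends (U.erase f) f := by
        rw [smul_smul, mul_assoc, mul_self_of_abs_le_one (hc1 f) ((hmemC f).1 hf), mul_one]
      _ = (b f * c f) • c := by rw [← key c hc hcU]
  have hfib : (treesIn ends A).filter (fun S => S ∪ C = U) = C.image U.erase := by
    ext S
    rw [mem_filter, mem_image, mem_treesIn]
    constructor
    · rintro ⟨⟨-, hS⟩, hSU⟩
      have hsub : S ⊆ U := hSU ▸ subset_union_left
      obtain ⟨f, hfS, hfU⟩ := exists_eq_insert_iff.2 ⟨hsub, hS.2.trans hUcard.symm⟩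
      have hfC : f ∈ S ∪ C := by rw [hSU, ← hfU]; exact mem_insert_self _ _
      exact ⟨f, (mem_union.1 hfC).resolve_left hfS, by rw [← hfU, erase_insert hfS]⟩
    · rintro ⟨f, hf, rfl⟩
      refine ⟨⟨(erase_subset _ _).trans hUA, htree f hf⟩, ?_⟩
      ext g
      have hgU : g ∈ C → g ∈ U := fun hg => IsFlow.mem_of_ne_zero hcU ((hmemC g).1 hg)
      rw [mem_union, mem_erase]
      by_cases hgf : g = f
      · subst hgf
        simp [hf, hgU hf]
      · simp only [ne_eq, hgf, not_false_eq_true, true_and]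
        tauto
  rw [hfib, sum_image fun f hf g hg hfg => erase_injOn U
    (IsFlow.mem_of_ne_zero hcU ((hmemC f).1 hf)) (IsFlow.mem_of_ne_zero hcU ((hmemC g).1 hg)) hfg]
  set r : V → ℤ := ∑ g ∈ A \ U, stdVec (chosenEnd ends θ T g) with hr
  have hterm : ∀ f ∈ C, ∀ θ', (θ' = θpos ∨ θ' = θneg) →
      treeTerm ends x A θ' (U.erase f) =
        x (U.erase f) + stdVec (chosenEnd ends θ' (U.erase f) f) + r := by
    intro f hf θ' hθ'
    have hfU := IsFlow.mem_of_ne_zero hcU ((hmemC f).1 hf)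
    have hSA : U.erase f ∈ treesIn ends A :=
      mem_treesIn.2 ⟨(erase_subset _ _).trans hUA, htree f hf⟩
    rw [treeTerm, sdiff_erase (hUA hfU), sum_insert (by simp [hfU]), ← add_assoc, hr]
    congr 1
    refine sum_congr rfl fun g hg => congrArg _ (chosenEnd_congr ?_)
    obtain ⟨hgA, hgU⟩ := mem_sdiff.1 hg
    have hgS : g ∉ U.erase f := fun h => hgU (mem_of_mem_erase h)
    have hgT : g ∉ T := fun h => hgU (mem_insert_of_mem h)
    have hsign : 0 < θ' ⬝ᵥ fundFlow ends (U.erase f) g ↔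
        0 < θ ⬝ᵥ fundFlow ends (U.erase f) g := by
      obtain ⟨l, hl⟩ | ⟨h1, h2⟩ := hwall _ hSA g (mem_sdiff.2 ⟨hgA, hgS⟩)
      · have := congrFun hl g
        rw [fundFlow_self hgS, Pi.smul_apply, hcU g hgU, smul_zero] at this
        exact absurd this one_ne_zero
      · rcases hθ' with rfl | rfl
        exacts [h1, h2]
    rw [hsign]
    have hdiff := hmul f hf _ (((htree f hf).isFlow_fundFlow g).sub (hT.isFlow_fundFlow g))
      fun j hj => by
        have hjS : j ∉ U.erase f := fun h => hj (mem_of_mem_erase h)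
        have hjT : j ∉ T := fun h => hj (mem_insert_of_mem h)
        rw [Pi.sub_apply, fundFlow_of_notMem hjS, fundFlow_of_notMem hjT, sub_self]
    have hdot := congrArg (θ ⬝ᵥ ·) hdiff
    simp only [dotProduct_sub, dotProduct_smul, hθ, smul_zero] at hdot
    rw [sub_eq_zero.1 hdot]
  have hfinal := hx U c hUconn hUcard hc hc0 hcU hc1 fun y => h (y + r)
  rw [← hfinal, ← sum_filter_of_ne (s := univ) (p := fun e => c e ≠ 0)]
  · refine sum_congr rfl fun f hf => ?_
    rw [hterm f hf _ (Or.inl rfl), hterm f hf _ (Or.inr rfl)]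
    have hflow : fundFlow ends (U.erase f) f = c f • c := by
      have := hmul f hf _ ((htree f hf).isFlow_fundFlow f) fun g hg => by
        have hgS : g ∉ U.erase f := fun h => hg (mem_of_mem_erase h)
        have hgf : g ≠ f := fun h =>
          hg (h ▸ IsFlow.mem_of_ne_zero hcU ((hmemC f).1 hf))
        rw [fundFlow_of_notMem hgS, if_neg hgf]
      rwa [fundFlow_self (notMem_erase f U), one_mul] at this
    obtain ⟨h1, h2⟩ := abs_le.1 (hc1 f)
    have h0 := (hmemC f).1 hf
    simp only [chosenEnd, hflow, dotProduct_smul]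
    obtain h3 | h3 : c f = 1 ∨ c f = -1 := by omega
    · simp [h3, hpos, hneg.not_gt]
    · simp [h3, hneg, hpos.not_gt]
  · intro f _ hf h0
    simp [h0] at hf

end WallCrossing

section Surjectivity

/-- A covector that is nonzero on all nonzero vectors with entries of size at most two. -/
def IsGeneric (θ : E → ℤ) : Prop := ∀ b : E → ℤ, (∀ f, |b f| ≤ 2) → θ ⬝ᵥ b = 0 → b = 0

variable (E) in
lemma exists_isGeneric : ∃ θ : E → ℤ, IsGeneric θ := by
  suffices h : ∀ s : Finset E, ∃ θ : E → ℤ, ∀ b : E → ℤ, (∀ f, |b f| ≤ 2) →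
      ∑ e ∈ s, θ e * b e = 0 → ∀ e ∈ s, b e = 0 by
    obtain ⟨θ, hθ⟩ := h univ
    exact ⟨θ, fun b hb h0 => funext fun e => hθ b hb h0 e (mem_univ e)⟩
  intro s
  induction s using Finset.induction_on with
  | empty => exact ⟨0, by simp⟩
  | insert a s ha ih =>
    obtain ⟨θ, hθ⟩ := ih
    refine ⟨fun e => if e = a then 1 else 3 * θ e, fun b hb h0 => ?_⟩
    have hs : ∑ e ∈ s, (if e = a then 1 else 3 * θ e) * b e = 3 * ∑ e ∈ s, θ e * b e := by
      rw [mul_sum]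
      refine sum_congr rfl fun e he => ?_
      rw [if_neg (ne_of_mem_of_not_mem he ha), mul_assoc]
    rw [sum_insert ha, hs] at h0
    simp only [if_true, one_mul] at h0
    have hba := abs_le.1 (hb a)
    have h1 : ∑ e ∈ s, θ e * b e = 0 := by omega
    rw [forall_mem_insert]
    exact ⟨by omega, hθ b hb h1⟩

/-- A line of covectors in the direction of the edge `e₀`. -/
def linePath (θ : E → ℤ) (e₀ : E) (t : ℤ) : E → ℤ := (2 : ℤ) • θ - t • Pi.single e₀ 1

lemma linePath_dotProduct (θ : E → ℤ) (e₀ : E) (t : ℤ) (b : E → ℤ) :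
    linePath θ e₀ t ⬝ᵥ b = 2 * (θ ⬝ᵥ b) - t * b e₀ := by
  simp only [linePath, sub_dotProduct, smul_dotProduct, single_one_dotProduct, smul_eq_mul]

variable {ends : E → V × V} {x : Finset E → V → ℤ} {A : Finset E} {θ : E → ℤ}

lemma CycleRelation.sum_linePath_step (hx : CycleRelation ends x) (hθ : IsGeneric θ) (e₀ : E)
    (n : ℤ) (h : (V → ℤ) → ℚ) :
    ∑ T ∈ treesIn ends A, h (treeTerm ends x A (linePath θ e₀ (2 * n - 1)) T) =
      ∑ T ∈ treesIn ends A, h (treeTerm ends x A (linePath θ e₀ (2 * n + 1)) T) := by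
  have hsign : ∀ b : E → ℤ, |b e₀| ≤ 1 → θ ⬝ᵥ b ≠ n * b e₀ →
      (0 < linePath θ e₀ (2 * n - 1) ⬝ᵥ b ↔ 0 < linePath θ e₀ (2 * n) ⬝ᵥ b) ∧
      (0 < linePath θ e₀ (2 * n + 1) ⬝ᵥ b ↔ 0 < linePath θ e₀ (2 * n) ⬝ᵥ b) := by
    intro b hb hne
    simp only [linePath_dotProduct, sub_mul, add_mul, mul_assoc, one_mul]
    have := abs_le.1 hb
    generalize n * b e₀ = m at *
    omega
  by_cases hwall : ∃ T ∈ treesIn ends A, ∃ e ∈ A \ T,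
      θ ⬝ᵥ fundFlow ends T e = n * fundFlow ends T e e₀
  · obtain ⟨T, hT, e, he, hdot⟩ := hwall
    have heT := (mem_sdiff.1 he).2
    have hflow := (mem_treesIn.1 hT).2.isFlow_fundFlow e
    set b := fundFlow ends T e with hb
    have hb1 : ∀ f, |b f| ≤ 1 := abs_fundFlow_le heT
    have hb0 : b e₀ ≠ 0 := by
      intro h0
      rw [h0, mul_zero] at hdot
      have := congrFun (hθ b (fun f => (hb1 f).trans one_le_two) hdot) e
      rw [hb, fundFlow_self heT] at this
      exact one_ne_zero this
    have hsq := mul_self_of_abs_le_one (hb1 e₀) hb0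
    have hdotc : θ ⬝ᵥ (b e₀ • b) = n := by
      rw [dotProduct_smul, hdot, smul_eq_mul, mul_left_comm, hsq, mul_one]
    have hce : (b e₀ • b) e₀ = 1 := by rw [Pi.smul_apply, smul_eq_mul, hsq]
    have hc1 : ∀ f, |(b e₀ • b) f| ≤ 1 := fun f => by
      rw [Pi.smul_apply, smul_eq_mul, abs_mul]
      exact mul_le_one₀ (hb1 e₀) (abs_nonneg _) (hb1 f)
    refine hx.sum_treeTerm_eq (θ := linePath θ e₀ (2 * n)) (c := b e₀ • b) (hflow.smul _) hc1
      ?_ ?_ ?_ (fun S hS g hg => ?_) h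
    · rw [linePath_dotProduct, hdotc, hce]; ring
    · rw [linePath_dotProduct, hdotc, hce]; omega
    · rw [linePath_dotProduct, hdotc, hce]; omega
    · have hgS := (mem_sdiff.1 hg).2
      have hg1 : ∀ f, |fundFlow ends S g f| ≤ 1 := abs_fundFlow_le hgS
      by_cases hzero : θ ⬝ᵥ fundFlow ends S g = n * fundFlow ends S g e₀
      · refine Or.inl ⟨fundFlow ends S g e₀, sub_eq_zero.1 (hθ _ (fun f => ?_) ?_)⟩
        · refine (abs_sub _ _).trans ?_
          have : |(fundFlow ends S g e₀ • b e₀ • b) f| ≤ 1 := by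
            rw [Pi.smul_apply, smul_eq_mul, abs_mul]
            exact mul_le_one₀ (hg1 e₀) (abs_nonneg _) (hc1 f)
          linarith [hg1 f]
        · rw [dotProduct_sub, dotProduct_smul, hdotc, hzero, smul_eq_mul, mul_comm, sub_self]
      · exact Or.inr (hsign _ (hg1 e₀) hzero)
  · push Not at hwall
    refine sum_congr rfl fun T hT => congrArg h (treeTerm_congr x fun e he => ?_)
    obtain ⟨h1, h2⟩ := hsign _ (abs_fundFlow_le (mem_sdiff.1 he).2 e₀) (hwall T hT e he)
    rw [h1, h2]

lemma CycleRelation.sum_linePath (hx : CycleRelation ends x) (hθ : IsGeneric θ) (e₀ : E)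
    (n : ℤ) (h : (V → ℤ) → ℚ) :
    ∑ T ∈ treesIn ends A, h (treeTerm ends x A (linePath θ e₀ (2 * n + 1)) T) =
      ∑ T ∈ treesIn ends A, h (treeTerm ends x A θ T) := by
  induction n using Int.induction_on with
  | zero =>
    refine sum_congr rfl fun T _ => congrArg h (treeTerm_congr x fun e he => ?_)
    have heT := (mem_sdiff.1 he).2
    have h1 := abs_le.1 (abs_fundFlow_le (ends := ends) heT e₀)
    have h2 : θ ⬝ᵥ fundFlow ends T e ≠ 0 := by
      intro h0
      have := congrFun (hθ _ (fun f => (abs_fundFlow_le heT f).trans one_le_two) h0) e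
      rw [fundFlow_self heT] at this
      exact one_ne_zero this
    rw [linePath_dotProduct]
    omega
  | succ n ih =>
    rw [← ih, ← hx.sum_linePath_step hθ e₀ (n + 1) h]
    ring_nf
  | pred n ih =>
    rw [← ih, ← hx.sum_linePath_step hθ e₀ (-n) h]
    ring_nf

lemma exists_eq_of_sum_eq {ι κ : Type*} {s : Finset ι} {p q : ι → κ}
    (hsum : ∀ h : κ → ℚ, ∑ i ∈ s, h (p i) = ∑ i ∈ s, h (q i)) {i : ι} (hi : i ∈ s) :
    ∃ j ∈ s, q j = p i := by
  classical
  by_contra! hne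
  have h1 := hsum fun k => if k = p i then 1 else 0
  rw [sum_eq_zero (s := s) (f := fun j => if q j = p i then (1 : ℚ) else 0)
    fun j hj => if_neg (hne j hj)] at h1
  have h2 := (sum_eq_zero_iff_of_nonneg fun j _ => by split_ifs <;> simp).1 h1 i hi
  simp at h2

lemma sum_fundFlow_sub_mem {T : Finset E} (hT : T ∈ treesIn ends A) {e₀ : E} (he₀ : e₀ ∈ A) :
    ∑ e ∈ A \ T, fundFlow ends T e e₀ • edgeVec ends e - edgeVec ends e₀ ∈ twGroup ends A := by
  obtain ⟨hTA, hT⟩ := mem_treesIn.1 hT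
  by_cases heT : e₀ ∈ T
  · have h1 : ∑ e ∈ A \ T, fundFlow ends T e e₀ • edgeVec ends e =
        -∑ e ∈ A \ T, cross ends T e₀ e • edgeVec ends e := by
      rw [← sum_neg_distrib]
      refine sum_congr rfl fun e he => ?_
      rw [fundFlow_of_mem (mem_sdiff.1 he).2 heT, neg_smul]
    have h2 : ∑ e ∈ T, cross ends T e₀ e • edgeVec ends e = edgeVec ends e₀ := by
      rw [sum_congr rfl fun e he => by rw [hT.cross_eq heT he]]
      simp [ite_smul, heT]
    rw [h1, ← h2, ← neg_add', sum_sdiff hTA]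
    exact neg_mem (laplacian_mem_twGroup ends A (headSide ends T e₀))
  · rw [sum_congr rfl fun e _ => by rw [fundFlow_of_notMem heT]]
    simp [ite_smul, he₀, heT]

lemma treeTerm_linePath_sub {t : ℤ} {T : Finset E} {e₀ : E}
    (ht : ∀ e ∈ A \ T, |2 * (θ ⬝ᵥ fundFlow ends T e)| < t) :
    treeTerm ends x A (linePath θ e₀ (-t)) T - treeTerm ends x A (linePath θ e₀ t) T =
      ∑ e ∈ A \ T, fundFlow ends T e e₀ • edgeVec ends e := by
  rw [treeTerm, treeTerm, add_sub_add_left_eq_sub, ← sum_sub_distrib]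
  refine sum_congr rfl fun e he => ?_
  have h1 := abs_le.1 (abs_fundFlow_le (ends := ends) (mem_sdiff.1 he).2 e₀)
  have h2 := abs_lt.1 (ht e he)
  simp only [chosenEnd, linePath_dotProduct]
  generalize fundFlow ends T e e₀ = k at *
  obtain rfl | rfl | rfl : k = -1 ∨ k = 0 ∨ k = 1 := by omega
  · rw [if_neg (by omega), if_pos (by omega), neg_smul, one_smul, edgeVec, neg_sub]
  · simp
  · rw [if_pos (by omega), if_neg (by omega), one_smul, edgeVec]

lemma CycleRelation.exists_treeTerm_shift (hx : CycleRelation ends x) (hθ : IsGeneric θ) {e₀ : E}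
    (he₀ : e₀ ∈ A) {T : Finset E} (hT : T ∈ treesIn ends A) :
    (∃ S ∈ treesIn ends A,
      treeTerm ends x A θ S - treeTerm ends x A θ T - edgeVec ends e₀ ∈ twGroup ends A) ∧
    ∃ S ∈ treesIn ends A,
      treeTerm ends x A θ S - treeTerm ends x A θ T + edgeVec ends e₀ ∈ twGroup ends A := by
  set n : ℤ := ∑ f, |θ f| with hn
  have hbound : ∀ S : Finset E, ∀ e ∈ A \ S, |2 * (θ ⬝ᵥ fundFlow ends S e)| < 2 * n + 1 := by
    intro S e he
    have h1 : |θ ⬝ᵥ fundFlow ends S e| ≤ n := by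
      refine (abs_sum_le_sum_abs _ _).trans (sum_le_sum fun f _ => ?_)
      rw [abs_mul]
      exact mul_le_of_le_one_right (abs_nonneg _) (abs_fundFlow_le (mem_sdiff.1 he).2 f)
    rw [abs_mul, abs_two]
    omega
  have hshift : ∀ S ∈ treesIn ends A, treeTerm ends x A (linePath θ e₀ (-(2 * n + 1))) S -
      treeTerm ends x A (linePath θ e₀ (2 * n + 1)) S - edgeVec ends e₀ ∈ twGroup ends A := by
    intro S hS
    rw [treeTerm_linePath_sub (hbound S)]
    exact sum_fundFlow_sub_mem hS he₀
  have hneg : -(2 * n + 1) = 2 * (-n - 1) + 1 := by ring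
  have hsum1 := hx.sum_linePath (A := A) hθ e₀ n
  have hsum2 := hx.sum_linePath (A := A) hθ e₀ (-n - 1)
  rw [← hneg] at hsum2
  constructor
  · obtain ⟨R, hR, hRT⟩ := exists_eq_of_sum_eq (fun h => (hsum1 h).symm) hT
    obtain ⟨S, hS, hSR⟩ := exists_eq_of_sum_eq hsum2 hR
    refine ⟨S, hS, ?_⟩
    rw [hSR, ← hRT]
    exact hshift R hR
  · obtain ⟨R, hR, hRT⟩ := exists_eq_of_sum_eq (fun h => (hsum2 h).symm) hT
    obtain ⟨S, hS, hSR⟩ := exists_eq_of_sum_eq hsum1 hR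
    refine ⟨S, hS, ?_⟩
    rw [hSR, ← hRT, ← neg_mem_iff]
    convert hshift R hR using 1
    abel

/-- The multidegrees obtained from spanning trees meet every class modulo twisters. -/
lemma CycleRelation.exists_treeTerm (hx : CycleRelation ends x) (hθ : IsGeneric θ)
    (hA : Conn ends A) {T : Finset E} (hT : T ∈ treesIn ends A) {y : V → ℤ}
    (hy : ∑ v, y v = ∑ v, treeTerm ends x A θ T v) :
    ∃ S ∈ treesIn ends A, y - treeTerm ends x A θ S ∈ twGroup ends A := by
  let G : AddSubgroup (V → ℤ) :=
    { carrier := {z | ∀ R ∈ treesIn ends A,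
        (∃ S ∈ treesIn ends A,
          treeTerm ends x A θ S - treeTerm ends x A θ R - z ∈ twGroup ends A) ∧
        ∃ S ∈ treesIn ends A,
          treeTerm ends x A θ S - treeTerm ends x A θ R + z ∈ twGroup ends A}
      zero_mem' := fun R hR => ⟨⟨R, hR, by simp⟩, ⟨R, hR, by simp⟩⟩
      neg_mem' := fun {z} hz R hR => by
        simpa only [sub_neg_eq_add, ← sub_eq_add_neg] using (hz R hR).symm
      add_mem' := fun {z w} hz hw R hR => by
        obtain ⟨⟨S, hS, hSR⟩, S', hS', hSR'⟩ := hz R hR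
        obtain ⟨Q, hQ, hQS⟩ := (hw S hS).1
        obtain ⟨Q', hQ', hQS'⟩ := (hw S' hS').2
        refine ⟨⟨Q, hQ, ?_⟩, Q', hQ', ?_⟩
        · convert add_mem hSR hQS using 1
          abel
        · convert add_mem hSR' hQS' using 1
          abel }
  obtain ⟨a, ha⟩ := hA.exists_edgeVec_sum (x := y - treeTerm ends x A θ T)
    (by simp only [Pi.sub_apply, sum_sub_distrib, hy, sub_self])
  have hmem : y - treeTerm ends x A θ T ∈ G := by
    rw [ha]
    refine sum_mem fun e he => zsmul_mem ?_ _
    exact fun R hR => hx.exists_treeTerm_shift hθ he hR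
  obtain ⟨S, hS, hST⟩ := (hmem T hT).1
  refine ⟨S, hS, ?_⟩
  rw [← neg_mem_iff]
  convert hST using 1
  abel

end Surjectivity

/-- If `σ` is a degree-`d` assignment for a connected multigraph `Γ`
satisfying chip-adding and `|σ(G)| ≥ c(G)` for all connected spanning subgraphs `G`, and
if the lift `σ̃` of `σ` to the subdivision `Γ̃` (each edge subdivided once) is a minimal
complete set of representatives for the twister group of `Γ̃`, then `σ` is a degree-`d`
stability assignment for `Γ`. -/
theorem statement0 (ends : E → V × V) (d : ℤ) (σ : Finset E → Set (V → ℤ))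
    (hconn : Conn ends (Finset.univ : Finset E))
    (hassign : IsAssignment ends d σ)
    (hchip : ChipAdding ends σ)
    (hcard : ∀ G : Finset E, Conn ends G → (complexity ends G : ℕ∞) ≤ (σ G).encard)
    (hlift : IsRepSet (subEnds ends fun _ => 1) d
      (Finset.univ : Finset (SubE E fun _ => 1)) (liftSet (fun _ => 1) σ)) :
    IsStabilityAssignment ends d σ := by
  have hσ : ∀ G, Nat.card (σ G) = complexity ends G := fun G =>
    natCard_eq_complexity hconn hcard hlift
  have hne : ∀ A, Conn ends A → (σ A).Nonempty := fun A hA => by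
    have h : Nat.card (σ A) ≠ 0 := hσ A ▸ hA.complexity_ne_zero
    exact Set.nonempty_coe_sort.1 (Nat.card_ne_zero.1 h).1
  choose! x hx using fun T (hT : IsSpanningTree ends T) => hne T hT.1
  have hrel := hchip.cycleRelation hσ hx
  obtain ⟨θ, hθ⟩ := exists_isGeneric E
  refine ⟨hassign, hchip, fun A hA =>
    isRepSet_of_natCard_eq hA (fun y hy => (hassign A y hy).2) (hσ A) fun y hy => ?_⟩
  obtain ⟨⟨T, hTA, hT⟩⟩ := (Nat.card_ne_zero.1 hA.complexity_ne_zero).1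
  have hTA := mem_treesIn.2 ⟨hTA, hT⟩
  obtain ⟨S, hS, hSy⟩ := hrel.exists_treeTerm hθ hA hTA
    (hy.out.trans (hassign A _ (hchip.treeTerm_mem hx hTA θ)).2.out.symm)
  exact ⟨_, hchip.treeTerm_mem hx hS θ, hSy⟩
end

section
/- Let H be a finite connected multigraph and let x, y ∈ ℤ^{Verts(H)} with x ≠ y. Suppose that for every nonempty proper subset W ⊊ Verts(H) such that both induced subgraphs H(W) and H(W^c) are connected, one has | Σ_{v∈W} (x(v) − y(v)) | < |E(W,W^c)|. Then x and y lie in different orbits of the twister group tw(H) acting on ℤ^{Verts(H)} by addition; equivalently, x − y ∉ tw(H). -/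
open Finset

variable {V E : Type} [Fintype V] [Fintype E] [DecidableEq V] [DecidableEq E]

set_option linter.unusedSectionVars false

/-- A nonempty vertex set whose induced subgraph is disconnected splits into two nonempty
parts with no edge between them. -/
theorem exists_separation_of_not_connOn (ends : E → V × V) {W : Finset V}
    (hW : W.Nonempty) (h : ¬ ConnOn ends W) :
    ∃ U ⊆ W, U.Nonempty ∧ (W \ U).Nonempty ∧
      ∀ a ∈ U, ∀ b ∈ W \ U, ∀ e : E, eSym ends e ≠ s(a, b) := by
  classical
  simp only [ConnOn, hW, true_and, not_forall] at h
  obtain ⟨v, hv, w, hw, hvw⟩ := h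
  refine ⟨W.filter fun u => Relation.ReflTransGen
      (fun a b => a ∈ W ∧ b ∈ W ∧ ∃ e : E, eSym ends e = s(a, b)) v u,
    filter_subset _ _, ⟨v, by simp [hv, Relation.ReflTransGen.refl]⟩, ⟨w, by simp [hw, hvw]⟩, ?_⟩
  intro a ha b hb e he
  simp only [mem_filter, mem_sdiff, not_and] at ha hb
  exact hb.2 hb.1 (ha.2.tail ⟨ha.1, hb.1, e, he⟩)

/-- In a connected multigraph every nonempty proper vertex set has a nonempty cut. -/
theorem cutE_nonempty_of_conn (ends : E → V × V) (hconn : Conn ends (univ : Finset E))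
    {W : Finset V} (hW : W.Nonempty) (hW' : W ≠ univ) : (cutE ends W).Nonempty := by
  by_contra hne
  obtain ⟨v, hv⟩ := hW
  refine hW' (eq_univ_iff_forall.2 fun w => ?_)
  induction hconn.2 v w with
  | refl => exact hv
  | tail _ hstep ih =>
    obtain ⟨e, -, he⟩ := hstep
    by_contra hc
    refine hne ⟨e, ?_⟩
    simp only [eSym, Sym2.eq_iff] at he
    simp only [cutE, mem_filter, mem_univ, true_and]
    rcases he with ⟨h1, h2⟩ | ⟨h1, h2⟩ <;> simp [h1, h2, ih, hc]

theorem cutE_compl (ends : E → V × V) (W : Finset V) : cutE ends Wᶜ = cutE ends W := by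
  ext e
  simp only [cutE, mem_filter, mem_univ, true_and, mem_compl]
  tauto

/-- In a connected multigraph, a nonempty union of components of a disconnected induced subgraph,
not containing all of them, has a strictly smaller cut. -/
theorem cutE_ssubset_of_separation (ends : E → V × V) (hconn : Conn ends (univ : Finset E))
    {U W : Finset V} (hUW : U ⊆ W) (hU : U.Nonempty) (hWU : (W \ U).Nonempty)
    (hsep : ∀ a ∈ U, ∀ b ∈ W \ U, ∀ e : E, eSym ends e ≠ s(a, b)) :
    cutE ends U ⊂ cutE ends W := by
  have key : ∀ e : E, ((ends e).1 ∈ U → (ends e).2 ∈ W → (ends e).2 ∈ U) ∧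
      ((ends e).2 ∈ U → (ends e).1 ∈ W → (ends e).1 ∈ U) := by
    refine fun e => ⟨fun h1 h2 => ?_, fun h1 h2 => ?_⟩
    · by_contra h3
      exact hsep _ h1 _ (mem_sdiff.2 ⟨h2, h3⟩) e rfl
    · by_contra h3
      exact hsep _ h1 _ (mem_sdiff.2 ⟨h2, h3⟩) e Sym2.eq_swap
  have hproper : W \ U ≠ univ := by
    obtain ⟨u, hu⟩ := hU
    intro h
    exact (mem_sdiff.1 (h ▸ mem_univ u)).2 hu
  obtain ⟨e, he⟩ := cutE_nonempty_of_conn ends hconn hWU hproper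
  rw [Finset.ssubset_iff_of_subset]
  · refine ⟨e, ?_, ?_⟩ <;>
      simp only [cutE, mem_filter, mem_univ, true_and, mem_sdiff] at he ⊢ <;>
      have := key e <;> have h1 := @hUW (ends e).1 <;> have h2 := @hUW (ends e).2 <;> tauto
  · intro e
    simp only [cutE, mem_filter, mem_univ, true_and]
    have := key e
    have h1 := @hUW (ends e).1
    have h2 := @hUW (ends e).2
    tauto

/-- Every cut of a connected multigraph contains a cut with both sides connected; if the given cut
is directed by a potential `f`, so is the new one. -/
theorem exists_connOn_directed_cut (ends : E → V × V) (hconn : Conn ends (univ : Finset E))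
    (f : V → ℤ) {W : Finset V} (hW : W.Nonempty) (hW' : W ≠ univ)
    (hf : ∀ e, ((ends e).1 ∈ W → (ends e).2 ∉ W → f (ends e).2 < f (ends e).1) ∧
      ((ends e).2 ∈ W → (ends e).1 ∉ W → f (ends e).1 < f (ends e).2)) :
    ∃ U : Finset V, U.Nonempty ∧ U ≠ univ ∧ ConnOn ends U ∧ ConnOn ends Uᶜ ∧
      ∀ e, ((ends e).1 ∈ U → (ends e).2 ∉ U → f (ends e).2 < f (ends e).1) ∧
        ((ends e).2 ∈ U → (ends e).1 ∉ U → f (ends e).1 < f (ends e).2) := by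
  induction hn : (cutE ends W).card using Nat.strong_induction_on generalizing W with
  | _ n ih =>
  subst hn
  by_cases h1 : ConnOn ends W
  · have hWc : Wᶜ.Nonempty := by rwa [nonempty_iff_ne_empty, Ne, compl_eq_empty_iff]
    by_cases h2 : ConnOn ends Wᶜ
    · exact ⟨W, hW, hW', h1, h2, hf⟩
    · obtain ⟨U, hU, hUne, hne, hsep⟩ := exists_separation_of_not_connOn ends hWc h2
      have hss := cutE_ssubset_of_separation ends hconn hU hUne hne hsep
      rw [cutE_compl, ← cutE_compl ends U] at hss
      refine ih _ (card_lt_card hss) ?_ ?_ (fun e => ?_) rfl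
      · exact hW.mono (subset_compl_comm.1 hU)
      · rwa [Ne, compl_eq_univ_iff, ← Ne, ← nonempty_iff_ne_empty]
      · have he := @hss.1 e
        have h3 := @hU (ends e).1
        have h4 := @hU (ends e).2
        simp only [cutE, mem_filter, mem_univ, true_and, mem_compl] at he h3 h4 ⊢
        grind [hf e]
  · obtain ⟨U, hU, hUne, hne, hsep⟩ := exists_separation_of_not_connOn ends hW h1
    have hss := cutE_ssubset_of_separation ends hconn hU hUne hne hsep
    refine ih _ (card_lt_card hss) hUne ?_ (fun e => ?_) rfl
    · rintro rfl
      exact hW' (univ_subset_iff.1 hU)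
    · have he := @hss.1 e
      have h3 := @hU (ends e).1
      have h4 := @hU (ends e).2
      simp only [cutE, mem_filter, mem_univ, true_and] at he
      grind [hf e]

/-- The twister at `v` as minus a row of the graph Laplacian, summed over edges. -/
theorem twVec_univ_apply (ends : E → V × V) (v w : V) :
    twVec ends (univ : Finset E) v w =
      -∑ e, ((if (ends e).1 = v then 1 else 0) - (if (ends e).2 = v then 1 else 0)) *
        ((if (ends e).1 = w then 1 else 0) - (if (ends e).2 = w then (1 : ℤ) else 0)) := by
  unfold twVec
  split_ifs with h
  · subst h
    rw [card_filter, Nat.cast_sum]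
    congr 1
    refine sum_congr rfl fun e _ => ?_
    simp only [eSym, Sym2.mem_iff, Sym2.mk_isDiag_iff]
    by_cases h1 : (ends e).1 = w <;> by_cases h2 : (ends e).2 = w <;>
      simp [h1, h2, eq_comm (a := w)]
  · rw [card_filter, Nat.cast_sum, ← sum_neg_distrib]
    refine sum_congr rfl fun e _ => ?_
    simp only [eSym, Sym2.eq_iff]
    by_cases h1 : (ends e).1 = w <;> by_cases h2 : (ends e).2 = w <;>
      by_cases h3 : (ends e).1 = v <;> by_cases h4 : (ends e).2 = v <;> simp_all

/-- Elements of the twister group are Laplacians of integral potentials. -/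
theorem exists_potential_of_mem_twGroup (ends : E → V × V) {z : V → ℤ}
    (hz : z ∈ twGroup ends (univ : Finset E)) :
    ∃ f : V → ℤ, ∀ w, z w = -∑ e, (f (ends e).1 - f (ends e).2) *
      ((if (ends e).1 = w then 1 else 0) - (if (ends e).2 = w then (1 : ℤ) else 0)) := by
  induction hz using AddSubgroup.closure_induction with
  | mem z hz =>
    obtain ⟨v, rfl⟩ := hz
    exact ⟨fun u => if u = v then 1 else 0, fun w => twVec_univ_apply ends v w⟩
  | zero => exact ⟨0, fun w => by simp⟩
  | add z z' _ _ h h' =>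
    obtain ⟨f, hf⟩ := h
    obtain ⟨g, hg⟩ := h'
    refine ⟨f + g, fun w => ?_⟩
    rw [Pi.add_apply, hf, hg, ← neg_add, ← sum_add_distrib]
    congr 1
    refine sum_congr rfl fun e _ => ?_
    simp only [Pi.add_apply]
    ring
  | neg z _ h =>
    obtain ⟨f, hf⟩ := h
    refine ⟨-f, fun w => ?_⟩
    rw [Pi.neg_apply, hf, ← sum_neg_distrib]
    congr 1
    refine sum_congr rfl fun e _ => ?_
    simp only [Pi.neg_apply]
    ring

/-- If `x ≠ y` and for every nonempty proper `W ⊊ Verts(H)` with both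
induced subgraphs connected one has `|Σ_{v∈W}(x v − y v)| < |E(W,Wᶜ)|`, then `x` and `y`
lie in different twister orbits, i.e. `x − y ∉ tw(H)`. -/
theorem statement2 (ends : E → V × V)
    (hconn : Conn ends (Finset.univ : Finset E))
    (x y : V → ℤ) (hxy : x ≠ y)
    (hcut : ∀ W : Finset V, W.Nonempty → W ≠ Finset.univ → ConnOn ends W → ConnOn ends Wᶜ →
      |∑ v ∈ W, (x v - y v)| < ((cutE ends W).card : ℤ)) :
    x - y ∉ twGroup ends (Finset.univ : Finset E) := by
  intro hmem
  obtain ⟨f, hf⟩ := exists_potential_of_mem_twGroup ends hmem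
  have hne : ∃ p q, f q < f p := by
    by_contra! hle
    refine hxy (sub_eq_zero.1 (funext fun w => ?_))
    rw [hf w]
    refine neg_eq_zero.2 (sum_eq_zero fun e _ => ?_)
    rw [le_antisymm (hle (ends e).1 (ends e).2) (hle _ _), sub_self, zero_mul]
  obtain ⟨p, q, hpq⟩ := hne
  obtain ⟨W, hW, hW', hc, hc', hdir⟩ := exists_connOn_directed_cut ends hconn f
    (W := univ.filter fun v => f p ≤ f v) ⟨p, by simp⟩
    (fun h => by simpa [hpq.not_ge] using h.ge (mem_univ q))
    (fun e => by simp only [mem_filter, mem_univ, true_and]; constructor <;> intros <;> omega)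
  refine (hcut W hW hW' hc hc').not_ge ((le_abs_self _).trans' ?_ |>.trans (abs_neg _).le)
  simp only [Pi.sub_apply] at hf
  simp only [hf]
  rw [sum_neg_distrib, neg_neg, sum_comm, cutE, card_filter, Nat.cast_sum]
  refine sum_le_sum fun e _ => ?_
  rw [← mul_sum, sum_sub_distrib, sum_ite_eq, sum_ite_eq]
  have := hdir e
  by_cases h1 : (ends e).1 ∈ W <;> by_cases h2 : (ends e).2 ∈ W <;>
    simp only [h1, h2, not_true, not_false_eq_true, true_implies, false_implies, and_true, true_and,
      and_false, or_false, or_true, if_true, if_false] at this ⊢ <;>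
    push_cast <;> omega
end
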